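/- Assume $1 \le d < q - 1$ and $1 \le r \le m+1$. The maximum number of common zeros in $\mathbb{P}^m(\mathbb{F}_q)$ of a system of $r$ linearly independent homogeneous polynomials of degree $d$ in $\mathbb{F}_q[x_0,\dots,x_m]$ equals $p_{m-r}$ if $d = 1$, and equals $(d-1)q^{m-1} + p_{m-2} + \lfloor q^{m-r} \rfloor$ if $d > 1$. Moreover, if $d > 1$ and the maximum is attained by $F_1, \dots, F_r$, then $F_1, \dots, F_r$ have a common linear factor. -/

import Mathlib

open MvPolynomial

/-- `pp q k` is the number of points of `ℙ^k(F_q)`, zero for negative `k`. -/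
noncomputable def pp (q : ℕ) (k : ℤ) : ℕ :=
  if k < 0 then 0 else ∑ i ∈ Finset.range (k.toNat + 1), q ^ i

/-- `flq q m r` is `⌊q^(m-r)⌋`: `q^(m-r)` for `r ≤ m` and `0` otherwise. -/
noncomputable def flq (q m r : ℕ) : ℕ := if r ≤ m then q ^ (m - r) else 0

/-- The Tsfasman–Boguslavsky bound: `p_(m-r)` if `d = 1`, and
`(d-1)q^(m-1) + p_(m-2) + ⌊q^(m-r)⌋` if `d > 1`. -/
noncomputable def Tbound (q d m r : ℕ) : ℕ :=
  if d = 1 then pp q ((m : ℤ) - r)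
  else (d - 1) * q ^ (m - 1) + pp q ((m : ℤ) - 2) + flq q m r

section MultiplicitySchwartzZippel

variable {K : Type*} [Field K]

/-- Translation of a polynomial by `a`. -/
noncomputable def shift {σ : Type*} (a : σ → K) : MvPolynomial σ K →ₐ[K] MvPolynomial σ K :=
  aeval fun i => X i + C (a i)

lemma shift_neg_shift {σ : Type*} (a : σ → K) (S : MvPolynomial σ K) :
    shift (-a) (shift a S) = S := by
  have : (shift (-a)).comp (shift a) = AlgHom.id K _ := by
    ext i
    simp [shift]
  exact DFunLike.congr_fun this S

lemma shift_injective {σ : Type*} (a : σ → K) : Function.Injective (shift a) :=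
  Function.LeftInverse.injective (shift_neg_shift a)

lemma mem_ker_eval_pow_of_coeff_shift {σ : Type*} (a : σ → K) (S : MvPolynomial σ K) (k : ℕ)
    (h : ∀ i : σ →₀ ℕ, i.degree < k → coeff i (shift a S) = 0) :
    S ∈ RingHom.ker (eval a) ^ k := by
  rw [← mem_pow_idealOfVars_iff'] at h
  have h1 := Ideal.mem_map_of_mem (shift (-a)) h
  rw [shift_neg_shift, Ideal.map_pow] at h1
  refine Ideal.pow_right_mono ?_ k h1
  rw [idealOfVars, Ideal.map_span, Ideal.span_le]
  rintro _ ⟨_, ⟨i, rfl⟩, rfl⟩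
  simp [shift, RingHom.mem_ker]

/-- Expansion of a polynomial in powers of `y - a`, with coefficients polynomials in the first
variable. -/
noncomputable def partialShift {n : ℕ} (a : Fin n → K) :
    MvPolynomial (Fin (n + 1)) K →+* MvPolynomial (Fin n) (Polynomial K) :=
  (Polynomial.eval₂RingHom ((map Polynomial.C).comp (shift a).toRingHom)
    (C Polynomial.X)).comp (finSuccEquiv K n).toRingEquiv.toRingHom

lemma coeff_coeff_partialShift {n : ℕ} (a : Fin n → K) (R : MvPolynomial (Fin (n + 1)) K)
    (i : Fin n →₀ ℕ) (s : ℕ) :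
    (coeff i (partialShift a R)).coeff s = coeff i (shift a ((finSuccEquiv K n R).coeff s)) := by
  have key : ∀ r : Polynomial (MvPolynomial (Fin n) K),
      (coeff i (Polynomial.eval₂RingHom ((map Polynomial.C).comp (shift a).toRingHom)
        (C Polynomial.X) r)).coeff s = coeff i (shift a (r.coeff s)) := by
    intro r
    induction r using Polynomial.induction_on' with
    | add p q hp hq => simp only [map_add, coeff_add, Polynomial.coeff_add, hp, hq]
    | monomial t b =>
      simp only [Polynomial.coe_eval₂RingHom, Polynomial.eval₂_monomial, ← map_pow]
      rw [mul_comm, coeff_C_mul]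
      simp only [RingHom.comp_apply, coeff_map, Polynomial.coeff_monomial]
      rw [Polynomial.coeff_X_pow_mul']
      simp only [Polynomial.coeff_C]
      rcases lt_trichotomy t s with h | rfl | h
      · simp [h.ne, h.le, Nat.sub_ne_zero_of_lt h]
      · simp
      · simp [h.ne', h.not_ge]
  exact key _

lemma eval_coeff_zero_partialShift {n : ℕ} (a : Fin n → K) (c : K)
    (R : MvPolynomial (Fin (n + 1)) K) :
    (coeff 0 (partialShift a R)).eval c = eval (Fin.cons c a : Fin (n + 1) → K) R := by
  have : ((Polynomial.evalRingHom c).comp constantCoeff).comp (partialShift a)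
      = eval (Fin.cons c a : Fin (n + 1) → K) := by
    apply MvPolynomial.ringHom_ext
    · intro r
      simp [partialShift, finSuccEquiv_apply]
    · intro i
      refine Fin.cases ?_ (fun j => ?_) i
      · simp [partialShift, finSuccEquiv_apply]
      · simp [partialShift, finSuccEquiv_apply, shift]
  exact RingHom.congr_fun this R

/-- Polynomials whose expansion at `0` vanishes to order `k` at the point `(c, 0)`. -/
noncomputable def orderIdeal {σ : Type*} (c : K) (k : ℕ) :
    Ideal (MvPolynomial σ (Polynomial K)) where
  carrier := {S | ∀ i : σ →₀ ℕ, (Polynomial.X - Polynomial.C c) ^ (k - i.degree) ∣ coeff i S}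
  add_mem' := fun ha hb i => by
    rw [coeff_add]
    exact dvd_add (ha i) (hb i)
  zero_mem' := fun i => by simp
  smul_mem' := fun a b hb i => by
    classical
    rw [smul_eq_mul, coeff_mul]
    refine Finset.dvd_sum fun x hx => Dvd.dvd.mul_left ((pow_dvd_pow _ ?_).trans (hb x.2)) _
    rw [Finset.HasAntidiagonal.mem_antidiagonal] at hx
    rw [← hx, map_add]
    omega

lemma orderIdeal_mul_le {σ : Type*} (c : K) (k l : ℕ) :
    orderIdeal (σ := σ) c k * orderIdeal c l ≤ orderIdeal c (k + l) := by
  classical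
  rw [Ideal.mul_le]
  intro r hr s hs i
  rw [coeff_mul]
  refine Finset.dvd_sum fun x hx => ?_
  rw [Finset.HasAntidiagonal.mem_antidiagonal] at hx
  refine (pow_dvd_pow _ ?_).trans ((pow_add _ _ _).dvd.trans (mul_dvd_mul (hr x.1) (hs x.2)))
  rw [← hx, map_add]
  omega

lemma orderIdeal_one_pow_le {σ : Type*} (c : K) (k : ℕ) :
    orderIdeal (σ := σ) c 1 ^ k ≤ orderIdeal c k := by
  induction k with
  | zero => intro S _ i; simp
  | succ k ih =>
    rw [pow_succ]
    exact (Ideal.mul_mono_left ih).trans (orderIdeal_mul_le c k 1)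

lemma pow_dvd_coeff_partialShift {n : ℕ} (a : Fin n → K) (c : K) (k : ℕ)
    (R : MvPolynomial (Fin (n + 1)) K)
    (h : R ∈ RingHom.ker (eval (Fin.cons c a : Fin (n + 1) → K)) ^ k) (i : Fin n →₀ ℕ) :
    (Polynomial.X - Polynomial.C c) ^ (k - i.degree) ∣ coeff i (partialShift a R) := by
  have h1 := Ideal.mem_map_of_mem (partialShift a) h
  rw [Ideal.map_pow] at h1
  have h2 : Ideal.map (partialShift a) (RingHom.ker (eval (Fin.cons c a : Fin (n + 1) → K)))
      ≤ orderIdeal c 1 := by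
    rw [Ideal.map_le_iff_le_comap]
    intro S hS j
    rw [RingHom.mem_ker] at hS
    by_cases hj : j = 0
    · subst hj
      simp only [map_zero, Nat.sub_zero, pow_one]
      rw [Polynomial.dvd_iff_isRoot, Polynomial.IsRoot, eval_coeff_zero_partialShift, hS]
    · have : j.degree ≠ 0 := fun h0 => hj ((Finsupp.degree_eq_zero_iff j).1 h0)
      rw [show 1 - j.degree = 0 by omega, pow_zero]
      exact one_dvd _
  exact orderIdeal_one_pow_le c k (Ideal.pow_right_mono h2 k h1) i

lemma sum_le_natDegree_of_pow_dvd [Fintype K] (P : Polynomial K) (hP : P ≠ 0) (k : K → ℕ)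
    (h : ∀ c, (Polynomial.X - Polynomial.C c) ^ k c ∣ P) : ∑ c, k c ≤ P.natDegree := by
  classical
  calc ∑ c, k c ≤ ∑ c, P.roots.count c := by
        refine Finset.sum_le_sum fun c _ => ?_
        rw [Polynomial.count_roots]
        exact (Polynomial.le_rootMultiplicity_iff hP).2 (h c)
    _ = Multiset.card P.roots := Multiset.sum_count_eq_card (by simp)
    _ ≤ P.natDegree := by
      exact (P.card_roots')

/-- The Schwartz–Zippel lemma with multiplicities. -/
theorem schwartz_zippel_multiplicity [Fintype K] : ∀ (n D : ℕ) (R : MvPolynomial (Fin n) K),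
    R ≠ 0 → R.totalDegree ≤ D → ∀ k : (Fin n → K) → ℕ,
    (∀ a, R ∈ RingHom.ker (eval a) ^ k a) →
    Fintype.card K * ∑ a, k a ≤ D * Fintype.card K ^ n := by
  intro n
  induction n with
  | zero =>
    intro D R hR _ k hk
    have : ∀ a, k a = 0 := by
      intro a
      by_contra h
      have h1 := Ideal.pow_le_self h (hk a)
      rw [RingHom.mem_ker] at h1
      obtain ⟨r, rfl⟩ := C_surjective (Fin 0) R
      simp_all
    simp [this]
  | succ n ih =>
    intro D R hR hD k hk
    set r := finSuccEquiv K n R with hr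
    have hr0 : r ≠ 0 := by simpa [hr] using hR
    set t := r.natDegree with ht
    set L := r.coeff t with hL
    have hL0 : L ≠ 0 := by simpa [hL, ht] using hr0
    have hLt : L.totalDegree + t ≤ D := (totalDegree_coeff_finSuccEquiv_add_le R t hL0).trans hD
    have hex : ∀ a : Fin n → K, ∃ i : Fin n →₀ ℕ, coeff i (shift a L) ≠ 0 ∧
        ∀ j : Fin n →₀ ℕ, j.degree < i.degree → coeff j (shift a L) = 0 := by
      intro a
      have hne : {i : Fin n →₀ ℕ | coeff i (shift a L) ≠ 0}.Nonempty := by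
        by_contra hcon
        rw [Set.not_nonempty_iff_eq_empty] at hcon
        apply hL0
        apply shift_injective a
        rw [map_zero]
        ext i
        by_contra h
        exact (Set.ext_iff.1 hcon i).1 h
      refine ⟨Function.argminOn Finsupp.degree _ hne, Function.argminOn_mem _ _ hne, ?_⟩
      intro j hj
      by_contra h
      exact Function.not_lt_argminOn Finsupp.degree _ h hj
    choose i hi0 hi using hex
    have hih := ih (D - t) L hL0 (by omega) (fun a => (i a).degree)
      (fun a => mem_ker_eval_pow_of_coeff_shift a L _ (hi a))
    have hfib : ∀ a : Fin n → K, ∑ c, k (Fin.cons c a) ≤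
        Fintype.card K * (i a).degree + t := by
      intro a
      have hP0 : coeff (i a) (partialShift a R) ≠ 0 := by
        intro h
        apply hi0 a
        rw [hL, hr, ← coeff_coeff_partialShift, h, Polynomial.coeff_zero]
      have hdeg : (coeff (i a) (partialShift a R)).natDegree ≤ t := by
        rw [Polynomial.natDegree_le_iff_coeff_eq_zero]
        intro s hs
        rw [coeff_coeff_partialShift, Polynomial.coeff_eq_zero_of_natDegree_lt hs]
        simp
      have h1 := sum_le_natDegree_of_pow_dvd _ hP0 (fun c => k (Fin.cons c a) - (i a).degree)
        (fun c => pow_dvd_coeff_partialShift a c _ R (hk _) (i a))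
      calc ∑ c, k (Fin.cons c a) ≤ ∑ c : K, ((i a).degree + (k (Fin.cons c a) - (i a).degree)) :=
            Finset.sum_le_sum fun c _ => by omega
        _ = Fintype.card K * (i a).degree + ∑ c : K, (k (Fin.cons c a) - (i a).degree) := by
            rw [Finset.sum_add_distrib]; simp
        _ ≤ _ := by gcongr; exact h1.trans hdeg
    have hsum : ∑ a, k a = ∑ a : Fin n → K, ∑ c, k (Fin.cons c a) := by
      rw [← (Fin.consEquiv fun _ => K).sum_comp, Fintype.sum_prod_type_right]
      rfl
    calc Fintype.card K * ∑ a, k a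
        ≤ Fintype.card K * ∑ a : Fin n → K, (Fintype.card K * (i a).degree + t) := by
          rw [hsum]; gcongr; exact hfib _
      _ = Fintype.card K * (Fintype.card K * ∑ a : Fin n → K, (i a).degree)
            + t * Fintype.card K ^ (n + 1) := by
          rw [Finset.sum_add_distrib, ← Finset.mul_sum]; simp; ring
      _ ≤ Fintype.card K * ((D - t) * Fintype.card K ^ n) + t * Fintype.card K ^ (n + 1) := by
          gcongr
      _ = ((D - t) + t) * Fintype.card K ^ (n + 1) := by ring
      _ = D * Fintype.card K ^ (n + 1) := by rw [Nat.sub_add_cancel (by omega)]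

end MultiplicitySchwartzZippel

section Determinant

variable {K : Type*} [Field K]

/-- If a matrix of polynomials has corank at least `k` at a point, then its determinant vanishes
to order `k` there. -/
lemma det_mem_ker_eval_pow {σ ι : Type*} [Fintype ι] [DecidableEq ι] (a : σ → K)
    (M : Matrix ι ι (MvPolynomial σ K)) (k : ℕ)
    (h : (M.map (eval a)).rank + k ≤ Fintype.card ι) : M.det ∈ RingHom.ker (eval a) ^ k := by
  classical
  obtain ⟨L, L', D, hD⟩ :=
    Matrix.Pivot.exists_list_transvec_mul_mul_list_transvec_eq_diagonal (M.map (eval a))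
  set P := (L.map Matrix.TransvectionStruct.toMatrix).prod with hP
  set P' := (L'.map Matrix.TransvectionStruct.toMatrix).prod with hP'
  have hPd : P.det = 1 := Matrix.TransvectionStruct.det_toMatrix_prod L
  have hPd' : P'.det = 1 := Matrix.TransvectionStruct.det_toMatrix_prod L'
  set N : Matrix ι ι (MvPolynomial σ K) := P.map C * M * P'.map C with hN
  have hNd : N.det = M.det := by
    rw [hN, Matrix.det_mul, Matrix.det_mul]
    have h1 : ∀ Q : Matrix ι ι K, (Q.map (C : K →+* MvPolynomial σ K)).det = C Q.det := fun Q => by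
      rw [RingHom.map_det]; rfl
    rw [h1, h1, hPd, hPd']
    simp
  have hNe : N.map (eval a) = Matrix.diagonal D := by
    rw [hN, Matrix.map_mul, Matrix.map_mul, Matrix.map_map, Matrix.map_map, ← hD]
    have h1 : ∀ Q : Matrix ι ι K, Q.map ((eval a) ∘ (C : K →+* MvPolynomial σ K)) = Q := by
      intro Q; ext i j; simp
    rw [h1, h1]
  have hrank : (Matrix.diagonal D).rank = (M.map (eval a)).rank := by
    rw [← hD, Matrix.rank_mul_eq_left_of_isUnit_det _ _ (by rw [hPd']; exact isUnit_one),
      Matrix.rank_mul_eq_right_of_isUnit_det _ _ (by rw [hPd]; exact isUnit_one)]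
  rw [Matrix.rank_diagonal] at hrank
  have hcard : k ≤ (Finset.univ.filter fun i => D i = 0).card := by
    have h1 := Finset.card_filter_add_card_filter_not (s := (Finset.univ : Finset ι))
      (fun i => D i = 0)
    have h2 : (Finset.univ.filter fun i => ¬ D i = 0).card = (M.map (eval a)).rank := by
      rw [← hrank, Fintype.card_subtype]
    rw [Finset.card_univ] at h1
    omega
  rw [← hNd, Matrix.det_apply]
  refine Ideal.sum_mem _ fun s _ => ?_
  rw [Units.smul_def, zsmul_eq_mul]
  refine Ideal.mul_mem_left _ _ ?_
  have h2 : ∏ i, N (s i) i ∈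
      ∏ i, (if D i = 0 then RingHom.ker (eval a) else (⊤ : Ideal (MvPolynomial σ K))) := by
    refine Ideal.prod_mem_prod fun i _ => ?_
    split_ifs with hi
    · rw [RingHom.mem_ker]
      have h3 := congrFun (congrFun hNe (s i)) i
      rw [Matrix.map_apply] at h3
      rw [h3, Matrix.diagonal_apply]
      split_ifs with h4
      · rw [h4, hi]
      · rfl
    · trivial
  rw [Finset.prod_ite, Finset.prod_const, Finset.prod_const, ← Ideal.one_eq_top, one_pow,
    mul_one] at h2
  exact Ideal.pow_le_pow_right hcard h2

open Polynomial in
/-- Distinct common roots bound the rank of the Sylvester matrix. -/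
lemma rank_sylvester_add_card_le (p g : K[X]) (e f : ℕ) (hp : p.natDegree ≤ e)
    (hg : g.natDegree ≤ f) (s : Finset K) (hs : ∀ c ∈ s, p.eval c = 0 ∧ g.eval c = 0)
    (hse : s.card ≤ e) :
    (p.sylvester g e f).rank + s.card ≤ e + f := by
  classical
  set v : Fin s.card → K := fun i => (s.equivFin.symm i : K) with hv
  have hvinj : Function.Injective v := fun i j hij => by
    simpa [hv, Subtype.ext_iff] using hij
  set V : Matrix (Fin s.card) (Fin (e + f)) K := Matrix.of fun i j => v i ^ (j : ℕ) with hV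
  have hVr : V.rank = s.card := by
    have h1 : LinearIndependent K V.row := by
      have h2 : LinearIndependent K (Matrix.vandermonde v).row :=
        Matrix.linearIndependent_rows_of_det_ne_zero
          (Matrix.det_vandermonde_ne_zero_iff.2 hvinj)
      rw [Fintype.linearIndependent_iff] at h2 ⊢
      intro c hc
      apply h2 c
      ext j
      have := congrFun hc ⟨j, by omega⟩
      simpa [hV, Matrix.vandermonde_apply, Matrix.row] using this
    simpa using h1.rank_matrix
  have hmul : V * p.sylvester g e f = 0 := by
    have key : ∀ (h : K[X]) (n t : ℕ) (c : K), h.natDegree ≤ n → t + n < e + f → h.eval c = 0 →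
        ∑ i : Fin (e + f), c ^ (i : ℕ) *
          (if (i : ℕ) ∈ Set.Icc t (t + n) then h.coeff (i - t) else 0) = 0 := by
      intro h n t c hn ht hc
      rw [Fin.sum_univ_eq_sum_range
        (fun i => c ^ i * (if i ∈ Set.Icc t (t + n) then h.coeff (i - t) else 0))]
      have h1 : ∑ i ∈ Finset.range (e + f),
          c ^ i * (if i ∈ Set.Icc t (t + n) then h.coeff (i - t) else 0)
          = ∑ i ∈ Finset.Ico t (t + n + 1), c ^ i * h.coeff (i - t) := by
        simp only [mul_ite, mul_zero]
        rw [← Finset.sum_filter]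
        refine Finset.sum_congr ?_ fun _ _ => rfl
        ext i
        simp only [Finset.mem_filter, Finset.mem_range, Set.mem_Icc, Finset.mem_Ico]
        omega
      rw [h1, Finset.sum_Ico_eq_sum_range, show t + n + 1 - t = n + 1 by omega]
      simp only [Nat.add_sub_cancel_left, pow_add, mul_assoc]
      rw [← Finset.mul_sum]
      rw [Polynomial.eval_eq_sum_range' (Nat.lt_succ_of_le hn)] at hc
      rw [show ∑ i ∈ Finset.range (n + 1), c ^ i * h.coeff i =
        ∑ i ∈ Finset.range n.succ, h.coeff i * c ^ i from
          Finset.sum_congr rfl fun i _ => mul_comm _ _, hc, mul_zero]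
    ext i j
    have hvi : v i ∈ s := (s.equivFin.symm i).2
    rw [Matrix.mul_apply]
    simp only [hV, Matrix.of_apply, Polynomial.sylvester, Matrix.zero_apply]
    induction j using Fin.addCases with
    | left j =>
      simp only [Fin.addCases_left]
      exact key g f j (v i) hg (by omega) (hs _ hvi).2
    | right j =>
      simp only [Fin.addCases_right]
      exact key p e j (v i) hp (by omega) (hs _ hvi).1
  have := Matrix.rank_add_rank_le_card_of_mul_eq_zero hmul
  rw [hVr, Fintype.card_fin] at this
  omega

end Determinant

section Bezout

lemma ncard_eq_sum_ite {α : Type*} [Fintype α] (S : Set α) [DecidablePred (· ∈ S)] :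
    S.ncard = ∑ x, if x ∈ S then 1 else 0 := by
  rw [Finset.sum_boole, Set.ncard_eq_toFinset_card', Set.toFinset_card, Fintype.card_subtype]
  rfl

lemma ncard_eq_sum_cons {K : Type*} [Fintype K] {n : ℕ} (S : Set (Fin (n + 1) → K)) :
    S.ncard = ∑ a : Fin n → K, {y : K | (Fin.cons y a : Fin (n + 1) → K) ∈ S}.ncard := by
  classical
  rw [ncard_eq_sum_ite, ← (Fin.consEquiv fun _ => K).sum_comp, Fintype.sum_prod_type_right]
  refine Finset.sum_congr rfl fun a _ => ?_
  rw [ncard_eq_sum_ite]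
  rfl

variable {K : Type*} [Field K]

lemma isHomogeneous_prod_of_forall {σ ι : Type*} (s : Finset ι) (φ : ι → MvPolynomial σ K)
    (b c : ι → ℕ) (h : ∀ i ∈ s, φ i = 0 ∨ ∃ k, k + b i = c i ∧ (φ i).IsHomogeneous k) :
    (∏ i ∈ s, φ i).IsHomogeneous (∑ i ∈ s, c i - ∑ i ∈ s, b i) := by
  by_cases h0 : ∃ i ∈ s, φ i = 0
  · obtain ⟨i, hi, h0⟩ := h0
    rw [Finset.prod_eq_zero hi h0]
    exact isHomogeneous_zero _ _ _
  · push Not at h0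
    have h1 : ∀ i ∈ s, b i ≤ c i ∧ (φ i).IsHomogeneous (c i - b i) := by
      intro i hi
      obtain h2 | ⟨k, hk, h3⟩ := h i hi
      · exact absurd h2 (h0 i hi)
      · refine ⟨by omega, ?_⟩
        rwa [show c i - b i = k by omega]
    rw [← Finset.sum_tsub_distrib s fun i hi => (h1 i hi).1]
    exact IsHomogeneous.prod s φ _ fun i hi => (h1 i hi).2

/-- The resultant of two homogeneous polynomials with respect to one variable is homogeneous. -/
lemma isHomogeneous_resultant {σ : Type*} (p g : Polynomial (MvPolynomial σ K)) (e f : ℕ)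
    (hp : ∀ i j, i + j = e → (p.coeff i).IsHomogeneous j)
    (hg : ∀ i j, i + j = f → (g.coeff i).IsHomogeneous j) :
    (p.resultant g e f).IsHomogeneous (e * f) := by
  rw [Polynomial.resultant, Matrix.det_apply]
  refine IsHomogeneous.sum _ _ _ fun s _ => ?_
  have key := isHomogeneous_prod_of_forall Finset.univ
    (fun j => p.sylvester g e f (s j) j) (fun j => (s j : ℕ))
    (Fin.addCases (fun j : Fin e => f + (j : ℕ)) (fun j : Fin f => e + (j : ℕ))) ?_
  · rw [Equiv.sum_comp s (fun i => (i : ℕ)), Fin.sum_univ_add, Fin.sum_univ_add] at key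
    simp only [Fin.addCases_left, Fin.addCases_right, Fin.val_castAdd, Fin.val_natAdd,
      Finset.sum_add_distrib, Finset.sum_const, Finset.card_univ, Fintype.card_fin,
      smul_eq_mul] at key
    rw [show e * f + ∑ i : Fin e, (i : ℕ) + (f * e + ∑ i : Fin f, (i : ℕ)) -
      (∑ i : Fin e, (i : ℕ) + (f * e + ∑ i : Fin f, (i : ℕ))) = e * f by omega] at key
    rw [Units.smul_def, zsmul_eq_mul]
    rcases Int.units_eq_one_or (Equiv.Perm.sign s) with h | h
    · rw [h]
      simpa using key
    · rw [h]
      simpa using key.neg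
  · intro j _
    simp only [Polynomial.sylvester, Matrix.of_apply]
    induction j using Fin.addCases with
    | left j =>
      simp only [Fin.addCases_left]
      split_ifs with h
      · rw [Set.mem_Icc] at h
        exact Or.inr ⟨f + j - s (Fin.castAdd f j), by omega, hg _ _ (by omega)⟩
      · exact Or.inl rfl
    | right j =>
      simp only [Fin.addCases_right]
      split_ifs with h
      · rw [Set.mem_Icc] at h
        exact Or.inr ⟨e + j - s (Fin.natAdd e j), by omega, hp _ _ (by omega)⟩
      · exact Or.inl rfl

lemma mem_ker_eval_zero_pow_of_isHomogeneous {σ : Type*} {F : MvPolynomial σ K} {d : ℕ}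
    (h : F.IsHomogeneous d) : F ∈ RingHom.ker (eval (0 : σ → K)) ^ d := by
  refine mem_ker_eval_pow_of_coeff_shift 0 F d fun i hi => ?_
  have h1 : shift (0 : σ → K) = AlgHom.id K _ := by
    ext i
    simp [shift]
  rw [h1]
  exact h.coeff_eq_zero hi.ne

/-- Bezout-type bound, when `P` does not vanish at the first coordinate point. -/
lemma bezout_of_eval_ne_zero [Fintype K] {m e f : ℕ} {P G : MvPolynomial (Fin (m + 1)) K}
    (hP : Irreducible P) (hPh : P.IsHomogeneous e) (hGh : G.IsHomogeneous f) (hPG : ¬ P ∣ G)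
    (hP0 : eval (Fin.cons 1 0 : Fin (m + 1) → K) P ≠ 0) :
    Fintype.card K * ({x : Fin (m + 1) → K | x ≠ 0 ∧ eval x P = 0 ∧ eval x G = 0}.ncard + e * f)
      ≤ e * f * Fintype.card K ^ m := by
  classical
  set p := finSuccEquiv K m P with hp
  set g := finSuccEquiv K m G with hg
  have hpc := hPh.finSuccEquiv_coeff_isHomogeneous
  have hgc := hGh.finSuccEquiv_coeff_isHomogeneous
  have hpd : p.natDegree ≤ e := by
    rw [hp, natDegree_finSuccEquiv]
    exact (degreeOf_le_totalDegree _ _).trans hPh.totalDegree_le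
  have hgd : g.natDegree ≤ f := by
    rw [hg, natDegree_finSuccEquiv]
    exact (degreeOf_le_totalDegree _ _).trans hGh.totalDegree_le
  obtain ⟨c, hc⟩ : ∃ c : K, p.coeff e = C c :=
    ⟨_, totalDegree_eq_zero_iff_eq_C.1
      ((totalDegree_zero_iff_isHomogeneous _).2 (hpc e 0 (by omega)))⟩
  have heval : ∀ y, eval (Fin.cons y 0 : Fin (m + 1) → K) P = c * y ^ e := by
    intro y
    rw [eval_eq_eval_mv_eval', Polynomial.eval_eq_sum_range'
      (n := e + 1) (Nat.lt_succ_of_le (Polynomial.natDegree_map_le.trans hpd)),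
      Finset.sum_range_succ, Finset.sum_eq_zero, Polynomial.coeff_map, hc]
    · simp
    · intro i hi
      rw [Finset.mem_range] at hi
      have h1 := hpc i (e - i) (by omega)
      have h2 : coeff 0 (p.coeff i) = 0 := h1.coeff_eq_zero (by simp; omega)
      rw [Polynomial.coeff_map, ← coe_aeval_eq_eval, RingHom.coe_coe, aeval_zero,
        constantCoeff_eq, h2]
      simp
  have hc0 : c ≠ 0 := by
    rintro rfl
    exact hP0 (by rw [heval, zero_mul])
  have hpe : p.natDegree = e := by
    refine le_antisymm hpd (Polynomial.le_natDegree_of_ne_zero ?_)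
    rw [hc]
    simpa using hc0
  have hpirr : Irreducible p := (MulEquiv.irreducible_iff (finSuccEquiv K m)).2 hP
  have hpg : ¬ p ∣ g := fun h => hPG ((map_dvd_iff (finSuccEquiv K m)).1 h)
  have he0 : e ≠ 0 := by
    rintro rfl
    rw [Polynomial.natDegree_eq_zero] at hpe
    obtain ⟨b, hb⟩ := hpe
    apply hpirr.not_isUnit
    rw [← hb, Polynomial.coeff_C_zero] at hc
    rw [← hb, hc]
    exact ((isUnit_iff_ne_zero.2 hc0).map C).map Polynomial.C
  have hprim : p.IsPrimitive := hpirr.isPrimitive (by omega)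
  set φ := algebraMap (MvPolynomial (Fin m) K) (FractionRing (MvPolynomial (Fin m) K)) with hφ
  have hφi : Function.Injective φ := IsFractionRing.injective _ _
  have hcop : IsCoprime (p.map φ) (g.map φ) := by
    rw [Irreducible.coprime_iff_not_dvd
      (hprim.irreducible_iff_irreducible_map_fraction_map.1 hpirr)]
    exact fun h => hpg (hprim.dvd_of_fraction_map_dvd_fraction_map h)
  set R := p.resultant g e f with hR
  have hR0 : R ≠ 0 := by
    have h1 := Polynomial.resultant_ne_zero _ _ hcop
    rw [Polynomial.natDegree_map_eq_of_injective hφi, Polynomial.natDegree_map_eq_of_injective hφi,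
      Polynomial.resultant_map_map] at h1
    have h2 : p.resultant g p.natDegree g.natDegree ≠ 0 := fun h => h1 (by rw [h, map_zero])
    obtain ⟨k, rfl⟩ := Nat.exists_eq_add_of_le hgd
    rw [hR, Polynomial.resultant_add_right_deg _ _ _ _ _ le_rfl, hc]
    refine mul_ne_zero (pow_ne_zero _ (by simpa using hc0)) ?_
    rwa [hpe] at h2
  have hRh : R.IsHomogeneous (e * f) := isHomogeneous_resultant p g e f hpc hgc
  set s : (Fin m → K) → Finset K := fun a => Finset.univ.filter fun y =>
    eval (Fin.cons y a : Fin (m + 1) → K) P = 0 ∧ eval (Fin.cons y a : Fin (m + 1) → K) G = 0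
    with hs
  have hmult : ∀ a, R ∈ RingHom.ker (eval a) ^ (if a = 0 then e * f else (s a).card) := by
    intro a
    split_ifs with ha
    · subst ha
      exact mem_ker_eval_zero_pow_of_isHomogeneous hRh
    · have h1 : ∀ y ∈ s a, (p.map (eval a)).eval y = 0 ∧ (g.map (eval a)).eval y = 0 := by
        intro y hy
        rw [hs, Finset.mem_filter] at hy
        rw [hp, hg, ← eval_eq_eval_mv_eval', ← eval_eq_eval_mv_eval']
        exact hy.2
      refine det_mem_ker_eval_pow a _ _ ?_
      rw [Fintype.card_fin]
      change ((eval a).mapMatrix (p.sylvester g e f)).rank + _ ≤ _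
      rw [← Polynomial.sylvester_map_map]
      refine rank_sylvester_add_card_le _ _ _ _ (Polynomial.natDegree_map_le.trans hpd)
        (Polynomial.natDegree_map_le.trans hgd) _ h1 ?_
      have h2 : p.map (eval a) ≠ 0 := by
        intro h
        have h3 : (p.map (eval a)).coeff e = 0 := by rw [h, Polynomial.coeff_zero]
        rw [Polynomial.coeff_map, hc, eval_C] at h3
        exact hc0 h3
      calc (s a).card ≤ (p.map (eval a)).roots.toFinset.card := by
            refine Finset.card_le_card fun y hy => ?_
            rw [Multiset.mem_toFinset, Polynomial.mem_roots h2]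
            exact (h1 y hy).1
        _ ≤ Multiset.card (p.map (eval a)).roots := Multiset.toFinset_card_le _
        _ ≤ (p.map (eval a)).natDegree := Polynomial.card_roots' _
        _ ≤ e := Polynomial.natDegree_map_le.trans hpd
  have hmain := schwartz_zippel_multiplicity m (e * f) R hR0 hRh.totalDegree_le _ hmult
  refine le_trans (Nat.mul_le_mul_left _ ?_) hmain
  rw [ncard_eq_sum_cons, ← Finset.add_sum_erase _ _ (Finset.mem_univ (0 : Fin m → K)),
    ← Finset.add_sum_erase _ _ (Finset.mem_univ (0 : Fin m → K)), if_pos rfl]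
  have h0 : {y : K | (Fin.cons y 0 : Fin (m + 1) → K) ∈ {x : Fin (m + 1) → K | x ≠ 0 ∧
      eval x P = 0 ∧ eval x G = 0}} = ∅ := by
    rw [Set.eq_empty_iff_forall_notMem]
    rintro y ⟨hy, hy1, -⟩
    rw [heval] at hy1
    have hy0 : y = 0 := by simpa [hc0, he0] using hy1
    apply hy
    ext i
    refine Fin.cases ?_ (fun j => ?_) i <;> simp [hy0]
  rw [h0, Set.ncard_empty, zero_add, add_comm]
  refine Nat.add_le_add_left (Finset.sum_le_sum fun a ha => ?_) _
  rw [if_neg (Finset.ne_of_mem_erase ha), ← Set.ncard_coe_finset]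
  refine Set.ncard_le_ncard ?_
  rintro y ⟨-, hy⟩
  simpa [hs] using hy

lemma eval_smul_of_isHomogeneous {σ : Type*} {F : MvPolynomial σ K} {d : ℕ}
    (h : F.IsHomogeneous d) (c : K) (x : σ → K) : eval (c • x) F = c ^ d * eval x F := by
  rw [eval_eq, eval_eq, Finset.mul_sum]
  refine Finset.sum_congr rfl fun i hi => ?_
  have h1 : i.degree = d := by
    by_contra h2
    exact (mem_support_iff.1 hi) (h.coeff_eq_zero h2)
  simp only [Pi.smul_apply, smul_eq_mul, mul_pow, Finset.prod_mul_distrib]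
  rw [Finset.prod_pow_eq_pow_sum, ← h1, Finsupp.degree_apply]
  ring

lemma exists_eval_cons_one_ne_zero [Fintype K] {m e : ℕ} {P : MvPolynomial (Fin (m + 1)) K}
    (hP : P ≠ 0) (hPh : P.IsHomogeneous e) (he : e + 1 ≤ Fintype.card K) :
    ∃ v : Fin m → K, eval (Fin.cons 1 v : Fin (m + 1) → K) P ≠ 0 := by
  have h1 : (X 0 * P).IsHomogeneous (1 + e) := (isHomogeneous_X K 0).mul hPh
  have h2 : ∃ x : Fin (m + 1) → K, eval x (X 0 * P) ≠ 0 := by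
    by_contra! h
    refine mul_ne_zero (X_ne_zero 0) hP
      (h1.eq_zero_of_forall_eval_eq_zero_of_le_card h ?_)
    rw [Cardinal.mk_fintype]
    exact_mod_cast (by omega : 1 + e ≤ Fintype.card K)
  obtain ⟨x, hx⟩ := h2
  rw [map_mul, eval_X] at hx
  have hx0 := left_ne_zero_of_mul hx
  refine ⟨fun i => (x 0)⁻¹ * x i.succ, fun h => right_ne_zero_of_mul hx ?_⟩
  have h3 : x = x 0 • (Fin.cons 1 fun i => (x 0)⁻¹ * x i.succ : Fin (m + 1) → K) := by
    ext i
    refine Fin.cases ?_ (fun j => ?_) i <;> simp [hx0]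
  rw [h3, eval_smul_of_isHomogeneous hPh, h, mul_zero]

/-- The substitution `X₀ ↦ X₀`, `Xᵢ ↦ Xᵢ + vᵢ X₀`. -/
noncomputable def shear {m : ℕ} (v : Fin m → K) :
    MvPolynomial (Fin (m + 1)) K →ₐ[K] MvPolynomial (Fin (m + 1)) K :=
  aeval (Fin.cons (X 0) fun i => X i.succ + C (v i) * X 0)

lemma shear_neg_comp_shear {m : ℕ} (v : Fin m → K) :
    (shear (-v)).comp (shear v) = AlgHom.id K _ := by
  ext i : 1
  refine Fin.cases ?_ (fun j => ?_) i <;> simp [shear]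

/-- The substitution `shear` as an automorphism. -/
noncomputable def shearEquiv {m : ℕ} (v : Fin m → K) :
    MvPolynomial (Fin (m + 1)) K ≃ₐ[K] MvPolynomial (Fin (m + 1)) K :=
  AlgEquiv.ofAlgHom (shear v) (shear (-v)) (by simpa using shear_neg_comp_shear (-v))
    (shear_neg_comp_shear v)

lemma eval_shearEquiv {m : ℕ} (v : Fin m → K) (x : Fin (m + 1) → K)
    (F : MvPolynomial (Fin (m + 1)) K) :
    eval x (shearEquiv v F) =
      eval (Fin.cons (x 0) fun i => x i.succ + v i * x 0 : Fin (m + 1) → K) F := by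
  have : (aeval x : MvPolynomial (Fin (m + 1)) K →ₐ[K] K).comp (shear v) =
      aeval (Fin.cons (x 0) fun i => x i.succ + v i * x 0 : Fin (m + 1) → K) := by
    ext i : 1
    refine Fin.cases ?_ (fun j => ?_) i <;> simp [shear]
  exact DFunLike.congr_fun this F

lemma isHomogeneous_shearEquiv {m d : ℕ} (v : Fin m → K) {F : MvPolynomial (Fin (m + 1)) K}
    (h : F.IsHomogeneous d) : (shearEquiv v F).IsHomogeneous d := by
  have h1 : shearEquiv v F =
      aeval (Fin.cons (X 0) fun i => X i.succ + C (v i) * X 0 :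
        Fin (m + 1) → MvPolynomial (Fin (m + 1)) K) F := rfl
  rw [h1, ← one_mul d]
  refine IsHomogeneous.aeval (σ := Fin (m + 1)) (τ := Fin (m + 1)) (S := K) h _ fun i => ?_
  refine Fin.cases ?_ (fun j => ?_) i
  · exact isHomogeneous_X K 0
  · exact (isHomogeneous_X K _).add ((isHomogeneous_X K _).C_mul _)

/-- A Bezout-type bound for the number of common zeros of a form and an irreducible form not
dividing it. -/
theorem card_common_zeros_irreducible_le [Fintype K] {m e f : ℕ}
    {P G : MvPolynomial (Fin (m + 1)) K} (hP : Irreducible P) (hPh : P.IsHomogeneous e)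
    (he : e + 1 ≤ Fintype.card K) (hGh : G.IsHomogeneous f) (hPG : ¬ P ∣ G) :
    Fintype.card K * ({x : Fin (m + 1) → K | x ≠ 0 ∧ eval x P = 0 ∧ eval x G = 0}.ncard + e * f)
      ≤ e * f * Fintype.card K ^ m := by
  obtain ⟨v, hv⟩ := exists_eval_cons_one_ne_zero hP.ne_zero hPh he
  have h1 := bezout_of_eval_ne_zero ((MulEquiv.irreducible_iff (shearEquiv v)).2 hP)
    (isHomogeneous_shearEquiv v hPh) (isHomogeneous_shearEquiv v hGh)
    (fun h => hPG ((map_dvd_iff (shearEquiv v)).1 h))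
    (by rw [eval_shearEquiv]; simpa using hv)
  refine le_trans (Nat.mul_le_mul_left _ (Nat.add_le_add_right ?_ _)) h1
  have key : ∀ x : Fin (m + 1) → K, (Fin.cons (x 0) fun i =>
      (x i.succ - v i * x 0) + v i * x 0 : Fin (m + 1) → K) = x := by
    intro x
    ext i
    refine Fin.cases ?_ (fun j => ?_) i <;> simp
  refine Set.ncard_le_ncard_of_injOn
    (fun x => (Fin.cons (x 0) fun i => x i.succ - v i * x 0 : Fin (m + 1) → K)) ?_ ?_
  · rintro x ⟨hx0, hx1, hx2⟩
    refine ⟨fun h => hx0 ?_, ?_, ?_⟩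
    · rw [← key x]
      ext i
      have h2 := congrFun h 0
      have h3 := fun j : Fin m => congrFun h j.succ
      simp only [Fin.cons_zero, Fin.cons_succ, Pi.zero_apply] at h2 h3
      refine Fin.cases ?_ (fun j => ?_) i
      · simpa using h2
      · simpa [h2] using h3 j
    · simpa only [eval_shearEquiv, Fin.cons_zero, Fin.cons_succ, key] using hx1
    · simpa only [eval_shearEquiv, Fin.cons_zero, Fin.cons_succ, key] using hx2
  · intro x _ y _ hxy
    simp only at hxy
    have h2 : x 0 = y 0 := congrFun hxy 0
    rw [← key x, ← key y]
    ext i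
    refine Fin.cases h2 (fun j => ?_) i
    have h3 := congrFun hxy j.succ
    simp only [Fin.cons_succ] at h3 ⊢
    rw [h3, h2]

end Bezout

section CoprimeSystem

variable {K : Type*} [Field K]

/-- The substitution `F ↦ F(tX)`. -/
noncomputable def scaleVars {σ : Type*} :
    MvPolynomial σ K →ₐ[K] Polynomial (MvPolynomial σ K) :=
  aeval fun i => Polynomial.monomial 1 (X i)

lemma scaleVars_monomial {σ : Type*} (s : σ →₀ ℕ) (c : K) :
    scaleVars (monomial s c) = Polynomial.monomial s.degree (monomial s c) := by
  rw [scaleVars, aeval_monomial, monomial_eq, Finsupp.prod, Finsupp.prod]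
  simp only [Polynomial.monomial_pow, one_mul]
  simp only [← Polynomial.C_mul_X_pow_eq_monomial]
  rw [Finset.prod_mul_distrib, Finset.prod_pow_eq_pow_sum, Finsupp.degree_apply, map_mul, map_prod,
    mul_assoc]
  rfl

lemma coeff_scaleVars {σ : Type*} (F : MvPolynomial σ K) (s : σ →₀ ℕ) (k : ℕ) :
    coeff s ((scaleVars F).coeff k) = if s.degree = k then coeff s F else 0 := by
  classical
  induction F using MvPolynomial.induction_on' with
  | monomial u a =>
    rw [scaleVars_monomial, Polynomial.coeff_monomial]
    split_ifs with h1 h2 h2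
    · rfl
    · rw [coeff_monomial, if_neg]
      rintro rfl
      exact h2 h1
    · rw [coeff_zero, coeff_monomial, if_neg]
      rintro rfl
      exact h1 h2
    · rfl
  | add p q hp hq =>
    simp only [map_add, Polynomial.coeff_add, coeff_add, hp, hq]
    split_ifs <;> simp

lemma isHomogeneous_iff_scaleVars {σ : Type*} (F : MvPolynomial σ K) (d : ℕ) :
    F.IsHomogeneous d ↔ scaleVars F = Polynomial.monomial d F := by
  constructor
  · intro h
    ext k s
    rw [coeff_scaleVars, Polynomial.coeff_monomial]
    split_ifs with h1 h2 h2
    · rfl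
    · rw [h.coeff_eq_zero (by omega), coeff_zero]
    · rw [h.coeff_eq_zero (by omega)]
    · rw [coeff_zero]
  · intro h s hs
    by_contra h1
    have h2 := coeff_scaleVars F s s.degree
    rw [h, Polynomial.coeff_monomial, if_pos rfl, if_neg, coeff_zero] at h2
    · exact hs h2.symm
    · intro h3
      apply h1
      rw [h3, Finsupp.degree_eq_weight_one]
      rfl

/-- Factors of a form are forms. -/
lemma exists_isHomogeneous_of_mul {σ : Type*} {A B : MvPolynomial σ K} {d : ℕ}
    (h : (A * B).IsHomogeneous d) (h0 : A * B ≠ 0) :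
    ∃ a b, a + b = d ∧ A.IsHomogeneous a ∧ B.IsHomogeneous b := by
  have hA0 := left_ne_zero_of_mul h0
  have hB0 := right_ne_zero_of_mul h0
  have hinj : ∀ F : MvPolynomial σ K, F ≠ 0 → scaleVars F ≠ 0 := by
    intro F hF h1
    obtain ⟨s, hs⟩ := MvPolynomial.ne_zero_iff.1 hF
    have h2 := coeff_scaleVars F s s.degree
    rw [h1, if_pos rfl, Polynomial.coeff_zero, coeff_zero] at h2
    exact hs h2.symm
  have key : ∀ F : MvPolynomial σ K, (scaleVars F).natTrailingDegree = (scaleVars F).natDegree →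
      F.IsHomogeneous (scaleVars F).natDegree := by
    intro F hF s hs
    have h2 := coeff_scaleVars F s s.degree
    rw [if_pos rfl] at h2
    have h3 : (scaleVars F).coeff s.degree ≠ 0 := by
      intro h4
      rw [h4, coeff_zero] at h2
      exact hs h2.symm
    have h4 := Polynomial.le_natDegree_of_ne_zero h3
    have h5 := Polynomial.natTrailingDegree_le_of_ne_zero h3
    rw [Finsupp.degree_eq_weight_one] at h4 h5
    exact le_antisymm h4 (hF ▸ h5)
  rw [isHomogeneous_iff_scaleVars, map_mul] at h
  have h1 := congrArg Polynomial.natDegree h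
  have h2 := congrArg Polynomial.natTrailingDegree h
  rw [Polynomial.natDegree_mul (hinj _ hA0) (hinj _ hB0),
    Polynomial.natDegree_monomial_eq _ h0] at h1
  rw [Polynomial.natTrailingDegree_mul (hinj _ hA0) (hinj _ hB0),
    Polynomial.natTrailingDegree_monomial h0] at h2
  have h3 := Polynomial.natTrailingDegree_le_natDegree (scaleVars A)
  have h4 := Polynomial.natTrailingDegree_le_natDegree (scaleVars B)
  exact ⟨_, _, h1, key A (by omega), key B (by omega)⟩

/-- A bound for the number of common zeros of a form `F` and a system `W` of forms having no
common irreducible factor with `F`. -/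
theorem card_common_zeros_coprime_le [Fintype K] {m f : ℕ} {ι : Type*}
    {W : ι → MvPolynomial (Fin (m + 1)) K} (hW : ∀ i, (W i).IsHomogeneous f)
    (F : MvPolynomial (Fin (m + 1)) K) :
    ∀ e, F ≠ 0 → F.IsHomogeneous e → e + 1 ≤ Fintype.card K →
    (∀ P, Irreducible P → P ∣ F → ∃ i, ¬ P ∣ W i) →
    Fintype.card K * ({x : Fin (m + 1) → K | x ≠ 0 ∧ eval x F = 0 ∧ ∀ i, eval x (W i) = 0}.ncard
      + e * f) ≤ e * f * Fintype.card K ^ m := by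
  induction F using WfDvdMonoid.induction_on_irreducible with
  | zero => intro e h; exact absurd rfl h
  | unit u hu =>
    intro e h0 hh _ _
    obtain ⟨c, hc, rfl⟩ := (MvPolynomial.isUnit_iff_eq_C_of_isReduced).1 hu
    have he : e = 0 := (hh.inj_right (isHomogeneous_C _ _) h0)
    subst he
    have : {x : Fin (m + 1) → K | x ≠ 0 ∧ eval x (C c) = 0 ∧ ∀ i, eval x (W i) = 0} = ∅ := by
      ext x
      simp [hc.ne_zero]
    rw [this]
    simp
  | mul F' P hF' hP ih =>
    intro e h0 hh he hco
    obtain ⟨a, b, rfl, ha, hb⟩ := exists_isHomogeneous_of_mul hh h0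
    obtain ⟨j, hj⟩ := hco P hP (dvd_mul_right _ _)
    have h1 := card_common_zeros_irreducible_le hP ha (by omega) (hW j) hj
    have h2 := ih b hF' hb (by omega) fun Q hQ hQF => hco Q hQ (hQF.mul_left _)
    have h3 : {x : Fin (m + 1) → K | x ≠ 0 ∧ eval x (P * F') = 0 ∧ ∀ i, eval x (W i) = 0}.ncard ≤
        {x : Fin (m + 1) → K | x ≠ 0 ∧ eval x P = 0 ∧ eval x (W j) = 0}.ncard +
        {x : Fin (m + 1) → K | x ≠ 0 ∧ eval x F' = 0 ∧ ∀ i, eval x (W i) = 0}.ncard := by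
      refine le_trans (Set.ncard_le_ncard ?_) (Set.ncard_union_le _ _)
      rintro x ⟨hx0, hx1, hx2⟩
      rw [map_mul, mul_eq_zero] at hx1
      rcases hx1 with hx1 | hx1
      · exact Or.inl ⟨hx0, hx1, hx2 j⟩
      · exact Or.inr ⟨hx0, hx1, hx2⟩
    nlinarith [Nat.mul_le_mul_left (Fintype.card K) h3]

end CoprimeSystem

section LinearForms

variable {K : Type*} [Field K]

/-- The linear form with coefficient vector `u`. -/
noncomputable def linForm {n : ℕ} (u : Fin n → K) : MvPolynomial (Fin n) K :=
  ∑ i, C (u i) * X i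

lemma eval_linForm {n : ℕ} (u x : Fin n → K) : eval x (linForm u) = u ⬝ᵥ x := by
  simp [linForm, dotProduct]

lemma isHomogeneous_linForm {n : ℕ} (u : Fin n → K) : (linForm u).IsHomogeneous 1 :=
  IsHomogeneous.sum _ _ _ fun i _ => (isHomogeneous_X K i).C_mul _

lemma linForm_ne_zero {n : ℕ} {u : Fin n → K} (hu : u ≠ 0) : linForm u ≠ 0 := by
  intro h
  apply hu
  apply dotProduct_eq_zero
  intro x
  rw [← eval_linForm, h, map_zero]

lemma exists_eq_linForm_of_isHomogeneous_one {n : ℕ} {F : MvPolynomial (Fin n) K}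
    (hF : F.IsHomogeneous 1) : ∃ u : Fin n → K, F = linForm u := by
  have h : F ∈ homogeneousSubmodule (Fin n) K 1 := hF
  rw [homogeneousSubmodule_one_eq_span_X, Submodule.mem_span_range_iff_exists_fun] at h
  obtain ⟨u, rfl⟩ := h
  exact ⟨u, by simp [linForm, smul_eq_C_mul]⟩

lemma totalDegree_aeval_le {σ τ : Type*} (F : MvPolynomial σ K) (g : σ → MvPolynomial τ K)
    (hg : ∀ i, (g i).totalDegree ≤ 1) : (aeval g F).totalDegree ≤ F.totalDegree := by
  rw [aeval_def, eval₂_eq]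
  refine totalDegree_finsetSum_le fun s hs => ?_
  refine (totalDegree_mul _ _).trans ?_
  rw [algebraMap_eq, totalDegree_C, zero_add]
  refine (totalDegree_finsetProd _ _).trans ((Finset.sum_le_sum fun i _ =>
    (totalDegree_pow _ _).trans (Nat.mul_le_mul_left _ (hg i))).trans ?_)
  simp only [mul_one]
  exact le_totalDegree hs

lemma dvd_aeval_sub_aeval {σ τ : Type*} (F : MvPolynomial σ K) (g h : σ → MvPolynomial τ K)
    (L : MvPolynomial τ K) (hgh : ∀ i, L ∣ g i - h i) : L ∣ aeval g F - aeval h F := by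
  rw [← Ideal.mem_span_singleton, ← Ideal.Quotient.eq]
  have : (Ideal.Quotient.mkₐ K (Ideal.span {L})).comp (aeval g) =
      (Ideal.Quotient.mkₐ K (Ideal.span {L})).comp (aeval h) := by
    ext i
    simp only [AlgHom.comp_apply, aeval_X, Ideal.Quotient.mkₐ_eq_mk]
    rw [Ideal.Quotient.eq, Ideal.mem_span_singleton]
    exact hgh i
  exact DFunLike.congr_fun this F

/-- The number of zeros of a polynomial of degree at most `D`. -/
lemma card_zeros_le [Fintype K] {n D : ℕ} (R : MvPolynomial (Fin n) K) (hR : R ≠ 0)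
    (hD : R.totalDegree ≤ D) :
    Fintype.card K * {x : Fin n → K | eval x R = 0}.ncard ≤ D * Fintype.card K ^ n := by
  classical
  rw [ncard_eq_sum_ite]
  refine schwartz_zippel_multiplicity n D R hR hD _ fun a => ?_
  split_ifs with h
  · rw [pow_one]
    exact h
  · simp

lemma exists_dotProduct_eq_one {n : ℕ} {u : Fin n → K} (hu : u ≠ 0) :
    ∃ w : Fin n → K, u ⬝ᵥ w = 1 := by
  obtain ⟨i, hi⟩ := Function.ne_iff.1 hu
  exact ⟨Pi.single i (u i)⁻¹, by simpa using mul_inv_cancel₀ hi⟩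

/-- Substitution of the projection along `w` onto the hyperplane where `u` takes the value `s`. -/
noncomputable def projSubst {n : ℕ} (u w : Fin n → K) (s : K) :
    MvPolynomial (Fin n) K →ₐ[K] MvPolynomial (Fin n) K :=
  aeval fun j => X j + C (w j) * (C s - linForm u)

lemma eval_projSubst {n : ℕ} (u w : Fin n → K) (s : K) (x : Fin n → K)
    (F : MvPolynomial (Fin n) K) :
    eval x (projSubst u w s F) = eval (x + (s - u ⬝ᵥ x) • w) F := by
  have : (aeval x : MvPolynomial (Fin n) K →ₐ[K] K).comp (projSubst u w s) =
      aeval (x + (s - u ⬝ᵥ x) • w) := by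
    ext i : 1
    simp [projSubst, aeval_eq_eval, eval_linForm, mul_comm]
  exact DFunLike.congr_fun this F

/-- A form vanishing on a hyperplane is divisible by the linear form of the hyperplane. -/
lemma linForm_dvd_of_forall_eval_eq_zero [Fintype K] {n e : ℕ} {F : MvPolynomial (Fin n) K}
    (hF : F.IsHomogeneous e) (he : e ≤ Fintype.card K) {u : Fin n → K} (hu : u ≠ 0)
    (h : ∀ x, u ⬝ᵥ x = 0 → eval x F = 0) : linForm u ∣ F := by
  obtain ⟨w, hw⟩ := exists_dotProduct_eq_one hu
  have h0 : projSubst u w 0 F = 0 := by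
    have h1 : (projSubst u w 0 F).IsHomogeneous (1 * e) := by
      refine IsHomogeneous.aeval (σ := Fin n) (τ := Fin n) (S := K) hF _ fun i => ?_
      refine (isHomogeneous_X K i).add (IsHomogeneous.C_mul ?_ _)
      rw [C_0]
      exact (isHomogeneous_zero _ _ _).sub (isHomogeneous_linForm u)
    refine h1.eq_zero_of_forall_eval_eq_zero_of_le_card (fun x => ?_) ?_
    · rw [eval_projSubst]
      apply h
      rw [dotProduct_add, dotProduct_smul, hw]
      simp
    · rw [Cardinal.mk_fintype, one_mul]
      exact_mod_cast he
  have h1 : linForm u ∣ aeval X F - projSubst u w 0 F := by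
    refine dvd_aeval_sub_aeval F _ _ _ fun i => ⟨C (w i), ?_⟩
    rw [C_0]
    ring
  rwa [h0, sub_zero, aeval_X_left_apply] at h1

/-- The number of zeros of a form outside a hyperplane. -/
lemma card_zeros_off_hyperplane_le [Fintype K] {n e : ℕ} {F : MvPolynomial (Fin (n + 1)) K}
    (hF0 : F ≠ 0) (hF : F.IsHomogeneous e) (he : e + 1 ≤ Fintype.card K) {u : Fin (n + 1) → K}
    (hu : u ≠ 0) :
    Fintype.card K * {x : Fin (n + 1) → K | eval x F = 0 ∧ u ⬝ᵥ x ≠ 0}.ncard ≤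
      e * (Fintype.card K - 1) * Fintype.card K ^ n := by
  classical
  obtain ⟨w, hw⟩ := exists_dotProduct_eq_one hu
  have hne : projSubst u w 1 F ≠ 0 := by
    have h1 : (linForm u * F).IsHomogeneous (1 + e) := (isHomogeneous_linForm u).mul hF
    have h2 : ∃ x : Fin (n + 1) → K, eval x (linForm u * F) ≠ 0 := by
      by_contra! h
      refine mul_ne_zero (linForm_ne_zero hu) hF0
        (h1.eq_zero_of_forall_eval_eq_zero_of_le_card h ?_)
      rw [Cardinal.mk_fintype]
      exact_mod_cast (by omega : 1 + e ≤ Fintype.card K)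
    obtain ⟨x, hx⟩ := h2
    rw [map_mul, eval_linForm] at hx
    have hx0 := left_ne_zero_of_mul hx
    intro h0
    have h3 := eval_projSubst u w 1 ((u ⬝ᵥ x)⁻¹ • x) F
    rw [h0, map_zero, dotProduct_smul, smul_eq_mul, inv_mul_cancel₀ hx0, sub_self, zero_smul,
      add_zero, eval_smul_of_isHomogeneous hF] at h3
    exact right_ne_zero_of_mul hx (by simpa [hx0] using h3.symm)
  have hdeg : (projSubst u w 1 F).totalDegree ≤ e := by
    refine (totalDegree_aeval_le F _ fun i => ?_).trans hF.totalDegree_le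
    refine (totalDegree_add _ _).trans (max_le (totalDegree_X i).le ?_)
    refine (totalDegree_mul _ _).trans ?_
    rw [totalDegree_C, zero_add]
    refine (totalDegree_sub _ _).trans (max_le ?_ (isHomogeneous_linForm u).totalDegree_le)
    rw [totalDegree_C]
    exact Nat.zero_le _
  have hz := card_zeros_le _ hne hdeg
  set A := {x : Fin (n + 1) → K | eval x F = 0 ∧ u ⬝ᵥ x = 1} with hA
  have h1 : {x : Fin (n + 1) → K | eval x F = 0 ∧ u ⬝ᵥ x ≠ 0}.ncard ≤
      (Fintype.card K - 1) * A.ncard := by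
    have h2 : (Fintype.card K - 1) = ({0}ᶜ : Set K).ncard := by
      rw [Set.ncard_compl, Set.ncard_singleton, Nat.card_eq_fintype_card]
    rw [h2, ← Set.ncard_prod]
    refine Set.ncard_le_ncard_of_injOn (fun x => (u ⬝ᵥ x, (u ⬝ᵥ x)⁻¹ • x)) ?_ ?_
    · rintro x ⟨hx, hx0⟩
      refine ⟨hx0, ?_, ?_⟩
      · rw [eval_smul_of_isHomogeneous hF, hx, mul_zero]
      · rw [dotProduct_smul, smul_eq_mul, inv_mul_cancel₀ hx0]
    · rintro x ⟨-, hx0⟩ y ⟨-, hy0⟩ hxy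
      simp only [Prod.mk.injEq] at hxy
      obtain ⟨h3, h4⟩ := hxy
      rw [h3] at h4
      exact smul_right_injective _ (inv_ne_zero hy0) h4
  have h3 : Fintype.card K * A.ncard ≤
      {x : Fin (n + 1) → K | eval x (projSubst u w 1 F) = 0}.ncard := by
    rw [← Nat.card_eq_fintype_card, ← Set.ncard_univ, ← Set.ncard_prod]
    refine Set.ncard_le_ncard_of_injOn (fun p => p.2 + p.1 • w) ?_ ?_
    · rintro ⟨t, x⟩ ⟨-, hx, hx1⟩
      simp only [Set.mem_ofPred_eq, eval_projSubst, dotProduct_add, dotProduct_smul, hw, hx1]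
      rw [← hx]
      congr 2
      ext i
      simp
    · rintro ⟨t, x⟩ ⟨-, -, hx1⟩ ⟨t', x'⟩ ⟨-, -, hx1'⟩ h
      simp only at h hx1 hx1'
      have h4 := congrArg (u ⬝ᵥ ·) h
      simp only [dotProduct_add, dotProduct_smul, hw, hx1, hx1'] at h4
      have h5 : t = t' := by simpa using h4
      subst h5
      simpa using h
  have hq : 0 < Fintype.card K := Fintype.card_pos
  have h4 : Fintype.card K * (Fintype.card K * A.ncard) ≤ e * Fintype.card K ^ (n + 1) :=
    (Nat.mul_le_mul_left _ h3).trans hz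
  have h5 : Fintype.card K * A.ncard ≤ e * Fintype.card K ^ n := by
    refine Nat.le_of_mul_le_mul_left (h4.trans (le_of_eq ?_)) hq
    ring
  calc Fintype.card K * {x : Fin (n + 1) → K | eval x F = 0 ∧ u ⬝ᵥ x ≠ 0}.ncard
      ≤ Fintype.card K * ((Fintype.card K - 1) * A.ncard) := Nat.mul_le_mul_left _ h1
    _ = (Fintype.card K - 1) * (Fintype.card K * A.ncard) := by ring
    _ ≤ (Fintype.card K - 1) * (e * Fintype.card K ^ n) := Nat.mul_le_mul_left _ h5
    _ = _ := by ring

/-- The number of zeros outside a hyperplane of a form vanishing on that hyperplane. -/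
lemma card_zeros_off_hyperplane_le_of_vanish [Fintype K] {n e : ℕ}
    {F : MvPolynomial (Fin (n + 1)) K}
    (hF0 : F ≠ 0) (hF : F.IsHomogeneous e) (he : e + 1 ≤ Fintype.card K) {u : Fin (n + 1) → K}
    (hu : u ≠ 0) (h : ∀ x, u ⬝ᵥ x = 0 → eval x F = 0) :
    Fintype.card K * {x : Fin (n + 1) → K | eval x F = 0 ∧ u ⬝ᵥ x ≠ 0}.ncard ≤
      (e - 1) * (Fintype.card K - 1) * Fintype.card K ^ n := by
  obtain ⟨G, rfl⟩ := linForm_dvd_of_forall_eval_eq_zero hF (by omega) hu h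
  obtain ⟨a, b, rfl, ha, hb⟩ := exists_isHomogeneous_of_mul hF hF0
  have ha1 : a = 1 := ha.inj_right (isHomogeneous_linForm u) (left_ne_zero_of_mul hF0)
  subst ha1
  have h1 := card_zeros_off_hyperplane_le (right_ne_zero_of_mul hF0) hb (by omega) hu
  rw [Nat.add_sub_cancel_left]
  convert h1 using 4
  ext x
  simp only [map_mul, eval_linForm, mul_eq_zero]
  tauto

end LinearForms

section NoLinearFactor

variable {K : Type*} [Field K]

/-- Double counting. -/
lemma mul_ncard_mul_le_of_incidence {α β : Type*} [Finite α] [Finite β] (R : α → β → Prop)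
    (S : Set α) (T : Set β) {t c M : ℕ} (hS : ∀ a ∈ S, c ≤ {b | b ∈ T ∧ R a b}.ncard)
    (hT : ∀ b ∈ T, t * {a | a ∈ S ∧ R a b}.ncard ≤ M) : t * (S.ncard * c) ≤ T.ncard * M := by
  classical
  have := Fintype.ofFinite α
  have := Fintype.ofFinite β
  rcases Nat.eq_zero_or_pos t with rfl | ht
  · simp
  have h1 := Finset.card_mul_le_card_mul (s := S.toFinset) (t := T.toFinset) (m := c)
    (n := M / t) R ?_ ?_
  · rw [← Set.ncard_eq_toFinset_card', ← Set.ncard_eq_toFinset_card'] at h1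
    calc t * (S.ncard * c) ≤ t * (T.ncard * (M / t)) := Nat.mul_le_mul_left _ h1
      _ = T.ncard * (t * (M / t)) := by ring
      _ ≤ T.ncard * M := Nat.mul_le_mul_left _ (Nat.mul_div_le _ _)
  · intro a ha
    refine (hS a (by simpa using ha)).trans (le_of_eq ?_)
    rw [Set.ncard_eq_toFinset_card']
    congr 1
    ext b
    simp [Finset.bipartiteAbove]
  · intro b hb
    rw [Nat.le_div_iff_mul_le ht, mul_comm]
    refine le_trans (le_of_eq ?_) (hT b (by simpa using hb))
    rw [Set.ncard_eq_toFinset_card']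
    congr 2
    ext a
    simp [Finset.bipartiteBelow]

/-- A parametrization of a hyperplane, with a left inverse. -/
lemma exists_hyperplane_parametrization {k : ℕ} {u : Fin (k + 1) → K} (hu : u ≠ 0) :
    ∃ (B : Matrix (Fin (k + 1)) (Fin k) K) (A : Matrix (Fin k) (Fin (k + 1)) K), A * B = 1 ∧
      (∀ y, u ⬝ᵥ B.mulVec y = 0) ∧ ∀ x, u ⬝ᵥ x = 0 → ∃ y, B.mulVec y = x := by
  set φ : Module.Dual K (Fin (k + 1) → K) := dotProductBilin K K u with hφ
  have hφa : ∀ x, φ x = u ⬝ᵥ x := fun x => rfl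
  have hφ0 : φ ≠ 0 := by
    intro h
    exact hu (dotProduct_eq_zero _ fun x => by rw [← hφa, h]; rfl)
  have h1 := Module.Dual.finrank_ker_add_one_of_ne_zero hφ0
  rw [Module.finrank_fin_fun, Nat.add_right_cancel_iff] at h1
  set b := Module.finBasisOfFinrankEq K _ h1
  set g : (Fin k → K) →ₗ[K] (Fin (k + 1) → K) :=
    (LinearMap.ker φ).subtype ∘ₗ b.equivFun.symm.toLinearMap with hg
  have hginj : LinearMap.ker g = ⊥ := by
    rw [LinearMap.ker_eq_bot]
    exact (LinearMap.ker φ).injective_subtype.comp b.equivFun.symm.injective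
  obtain ⟨h, hh⟩ := g.exists_leftInverse_of_injective hginj
  refine ⟨LinearMap.toMatrix' g, LinearMap.toMatrix' h, ?_, ?_, ?_⟩
  · rw [← LinearMap.toMatrix'_comp, hh, LinearMap.toMatrix'_id]
  · intro y
    rw [LinearMap.toMatrix'_mulVec, ← hφa]
    exact (b.equivFun.symm y).2
  · intro x hx
    refine ⟨b.equivFun ⟨x, hx⟩, ?_⟩
    rw [LinearMap.toMatrix'_mulVec, hg]
    simp

lemma mulVec_injective_of_left_inverse {k l : ℕ} {B : Matrix (Fin l) (Fin k) K}
    {A : Matrix (Fin k) (Fin l) K} (h : A * B = 1) : Function.Injective B.mulVec := by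
  intro x y hxy
  have h1 := congrArg A.mulVec hxy
  simpa [Matrix.mulVec_mulVec, h] using h1

lemma ncard_hyperplane [Fintype K] {k : ℕ} {u : Fin (k + 1) → K} (hu : u ≠ 0) :
    {x : Fin (k + 1) → K | u ⬝ᵥ x = 0}.ncard = Fintype.card K ^ k := by
  obtain ⟨B, A, hAB, h1, h2⟩ := exists_hyperplane_parametrization hu
  have h3 : {x : Fin (k + 1) → K | u ⬝ᵥ x = 0} = B.mulVec '' Set.univ := by
    ext x
    constructor
    · intro hx
      obtain ⟨y, hy⟩ := h2 x hx
      exact ⟨y, trivial, hy⟩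
    · rintro ⟨y, -, rfl⟩
      exact h1 y
  rw [h3, Set.ncard_image_of_injective _ (mulVec_injective_of_left_inverse hAB), Set.ncard_univ]
  simp

lemma ncard_hyperplane_ne_zero [Fintype K] {k : ℕ} {u : Fin (k + 1) → K} (hu : u ≠ 0) :
    {x : Fin (k + 1) → K | x ≠ 0 ∧ x ⬝ᵥ u = 0}.ncard = Fintype.card K ^ k - 1 := by
  have h1 : {x : Fin (k + 1) → K | x ≠ 0 ∧ x ⬝ᵥ u = 0} = {x | u ⬝ᵥ x = 0} \ {0} := by
    ext x
    simp [dotProduct_comm u x, and_comm]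
  rw [h1, Set.ncard_sdiff_singleton_of_mem (by simp), ncard_hyperplane hu]

/-- Composition of a polynomial with a linear map. -/
noncomputable def pullback {k l : ℕ} (B : Matrix (Fin l) (Fin k) K) :
    MvPolynomial (Fin l) K →ₐ[K] MvPolynomial (Fin k) K :=
  aeval fun i => linForm (B i)

lemma eval_pullback {k l : ℕ} (B : Matrix (Fin l) (Fin k) K) (F : MvPolynomial (Fin l) K)
    (y : Fin k → K) : eval y (pullback B F) = eval (B.mulVec y) F := by
  have : (aeval y : MvPolynomial (Fin k) K →ₐ[K] K).comp (pullback B) = aeval (B.mulVec y) := by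
    ext i : 1
    simp [pullback, aeval_eq_eval, eval_linForm, Matrix.mulVec]
  exact DFunLike.congr_fun this F

lemma isHomogeneous_pullback {k l d : ℕ} (B : Matrix (Fin l) (Fin k) K)
    {F : MvPolynomial (Fin l) K} (hF : F.IsHomogeneous d) : (pullback B F).IsHomogeneous d := by
  rw [← one_mul d]
  exact IsHomogeneous.aeval (σ := Fin l) (τ := Fin k) (S := K) hF _
    fun i => isHomogeneous_linForm (B i)

lemma ncard_image_mulVec_le [Finite K] {k l : ℕ} {B : Matrix (Fin l) (Fin k) K}
    (S : Set (Fin l → K)) (hS : ∀ x ∈ S, ∃ y, B.mulVec y = x) :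
    S.ncard ≤ {y | B.mulVec y ∈ S}.ncard := by
  refine le_trans (Set.ncard_le_ncard ?_) (Set.ncard_image_le (f := B.mulVec))
  intro x hx
  obtain ⟨y, rfl⟩ := hS x hx
  exact ⟨y, hx, rfl⟩

/-- The zeros of a form that vanishes on a subspace of codimension two but on no hyperplane. -/
lemma card_zeros_le_of_vanish_codim_two [Fintype K] {k e : ℕ}
    {F : MvPolynomial (Fin (k + 2)) K} (hF : F.IsHomogeneous e) (he : e + 1 ≤ Fintype.card K)
    (hyp : ∀ u : Fin (k + 2) → K, u ≠ 0 → ∃ x, u ⬝ᵥ x = 0 ∧ eval x F ≠ 0)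
    {a b : Fin (k + 2) → K} (hab : ∀ α β : K, α • a + β • b = 0 → α = 0 ∧ β = 0)
    (hv : ∀ x, a ⬝ᵥ x = 0 → b ⬝ᵥ x = 0 → eval x F = 0)
    (hcard : {x : Fin (k + 2) → K | a ⬝ᵥ x = 0 ∧ b ⬝ᵥ x = 0}.ncard ≤ Fintype.card K ^ k) :
    Fintype.card K * {x : Fin (k + 2) → K | x ≠ 0 ∧ eval x F = 0}.ncard + Fintype.card K ≤
      Fintype.card K ^ (k + 1) +
        (Fintype.card K + 1) * ((e - 1) * (Fintype.card K - 1) * Fintype.card K ^ k) := by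
  have hq : 1 < Fintype.card K := Fintype.one_lt_card
  set S := {x : Fin (k + 2) → K | eval x F = 0 ∧ ¬ (a ⬝ᵥ x = 0 ∧ b ⬝ᵥ x = 0)} with hS
  have hline : ∀ h c : Fin (k + 2) → K, h ≠ 0 →
      (∀ x, h ⬝ᵥ x = 0 → (c ⬝ᵥ x = 0 ↔ (a ⬝ᵥ x = 0 ∧ b ⬝ᵥ x = 0))) →
      Fintype.card K * {x | x ∈ S ∧ h ⬝ᵥ x = 0}.ncard ≤
        (e - 1) * (Fintype.card K - 1) * Fintype.card K ^ k := by
    intro h c hh hc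
    obtain ⟨B, A, hAB, h1, h2⟩ := exists_hyperplane_parametrization hh
    obtain ⟨x, hx, hxF⟩ := hyp h hh
    obtain ⟨y, rfl⟩ := h2 x hx
    have hc0 : Matrix.vecMul c B ≠ 0 := by
      intro h0
      have h3 : c ⬝ᵥ B.mulVec y = 0 := by rw [Matrix.dotProduct_mulVec, h0, zero_dotProduct]
      have h4 := (hc _ hx).1 h3
      exact hxF (hv _ h4.1 h4.2)
    have h3 := card_zeros_off_hyperplane_le_of_vanish (F := pullback B F) (u := Matrix.vecMul c B)
      (fun h0 => hxF (by rw [← eval_pullback, h0, map_zero]))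
      (isHomogeneous_pullback B hF) he hc0 ?_
    · refine le_trans (Nat.mul_le_mul_left _ ?_) h3
      refine (ncard_image_mulVec_le (B := B) _ fun x hx => h2 x hx.2).trans
        (Set.ncard_le_ncard ?_)
      rintro z ⟨⟨hz1, hz2⟩, hz3⟩
      refine ⟨by rwa [eval_pullback], ?_⟩
      rw [← Matrix.dotProduct_mulVec]
      exact fun h5 => hz2 ((hc _ hz3).1 h5)
    · intro z hz
      rw [← Matrix.dotProduct_mulVec, hc _ (h1 z)] at hz
      rw [eval_pullback]
      exact hv _ hz.1 hz.2
  have hdc := mul_ncard_mul_le_of_incidence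
    (fun (x : Fin (k + 2) → K) (p : Fin 2 → K) => (p 0 • a + p 1 • b) ⬝ᵥ x = 0) S {0}ᶜ
    (t := Fintype.card K) (c := Fintype.card K - 1)
    (M := (e - 1) * (Fintype.card K - 1) * Fintype.card K ^ k) ?_ ?_
  · have h1 : ({0}ᶜ : Set (Fin 2 → K)).ncard = Fintype.card K ^ 2 - 1 := by
      rw [Set.ncard_compl, Set.ncard_singleton]
      simp
    rw [h1, show Fintype.card K ^ 2 - 1 = (Fintype.card K + 1) * (Fintype.card K - 1) by
      rw [← Nat.sq_sub_sq, one_pow]] at hdc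
    have h2 : Fintype.card K * S.ncard ≤
        (Fintype.card K + 1) * ((e - 1) * (Fintype.card K - 1) * Fintype.card K ^ k) := by
      refine Nat.le_of_mul_le_mul_right (c := Fintype.card K - 1) ?_ (by omega)
      calc _ = _ := by ring
        _ ≤ _ := hdc
        _ = _ := by ring
    have h3 : {x : Fin (k + 2) → K | x ≠ 0 ∧ eval x F = 0}.ncard + 1 ≤
        {x : Fin (k + 2) → K | a ⬝ᵥ x = 0 ∧ b ⬝ᵥ x = 0}.ncard + S.ncard := by
      rw [← Set.ncard_insert_of_notMem (a := (0 : Fin (k + 2) → K)) (by simp)]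
      refine le_trans (Set.ncard_le_ncard ?_) (Set.ncard_union_le _ _)
      intro x hx
      by_cases h : a ⬝ᵥ x = 0 ∧ b ⬝ᵥ x = 0
      · exact Or.inl h
      · refine Or.inr ⟨?_, h⟩
        rcases hx with rfl | hx
        · simp at h
        · exact hx.2
    calc _ = Fintype.card K * ({x : Fin (k + 2) → K | x ≠ 0 ∧ eval x F = 0}.ncard + 1) := by ring
      _ ≤ Fintype.card K * (Fintype.card K ^ k + S.ncard) :=
        Nat.mul_le_mul_left _ (h3.trans (Nat.add_le_add_right hcard _))
      _ = Fintype.card K ^ (k + 1) + Fintype.card K * S.ncard := by ring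
      _ ≤ _ := by gcongr
  · rintro x ⟨-, hx⟩
    have h0 : ![a ⬝ᵥ x, b ⬝ᵥ x] ≠ 0 := by
      intro h
      exact hx ⟨congrFun h 0, congrFun h 1⟩
    have h1 := ncard_hyperplane_ne_zero h0
    rw [pow_one] at h1
    rw [← h1]
    refine Set.ncard_le_ncard ?_
    rintro p ⟨hp0, hp⟩
    refine ⟨hp0, ?_⟩
    rw [add_dotProduct, smul_dotProduct, smul_dotProduct]
    simpa [dotProduct, Fin.sum_univ_two] using hp
  · intro p hp
    have hh : p 0 • a + p 1 • b ≠ 0 := by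
      intro h
      obtain ⟨h1, h2⟩ := hab _ _ h
      apply hp
      ext i
      fin_cases i
      · exact h1
      · exact h2
    by_cases hp1 : p 1 = 0
    · have hp0 : p 0 ≠ 0 := by
        intro h
        simp [h, hp1] at hh
      refine hline _ b hh fun x hx => ?_
      simp [hp1, hp0] at hx
      simp [hx]
    · refine hline _ a hh fun x hx => ?_
      simp only [add_dotProduct, smul_dotProduct, smul_eq_mul] at hx
      constructor
      · intro h
        rw [h] at hx
        simpa [h, hp1] using hx
      · exact fun h => h.1

/-- A bound for the number of nontrivial zeros of a form without linear factors. -/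
theorem card_zeros_le_of_no_hyperplane [Fintype K] (k : ℕ) : ∀ {e : ℕ}
    {F : MvPolynomial (Fin k) K}, F.IsHomogeneous e → 1 ≤ e → e + 1 ≤ Fintype.card K →
    (∀ u : Fin k → K, u ≠ 0 → ∃ x, u ⬝ᵥ x = 0 ∧ eval x F ≠ 0) →
    Fintype.card K ^ 2 * {x : Fin k → K | x ≠ 0 ∧ eval x F = 0}.ncard +
      e * (Fintype.card K - 1) ≤ e * (Fintype.card K - 1) * Fintype.card K ^ k := by
  induction k with
  | zero =>
    intro e F hF he1 he hyp
    have : {x : Fin 0 → K | x ≠ 0 ∧ eval x F = 0} = ∅ := by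
      rw [Set.eq_empty_iff_forall_notMem]
      exact fun x hx => hx.1 (Subsingleton.elim _ _)
    rw [this, Set.ncard_empty]
    simp
  | succ k ih =>
    intro e F hF he1 he hyp
    have hq : 1 < Fintype.card K := Fintype.one_lt_card
    have hF0 : eval (0 : Fin (k + 1) → K) F = 0 := by
      have h1 := eval_smul_of_isHomogeneous hF 0 0
      simpa [show e ≠ 0 by omega] using h1
    obtain _ | k := k
    · exfalso
      obtain ⟨x, hx, hxF⟩ := hyp (fun _ => 1) (fun h => one_ne_zero (congrFun h 0))
      apply hxF
      have : x = 0 := by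
        ext i
        simpa [dotProduct, Fin.eq_zero i] using hx
      rw [this, hF0]
    have hqk : 1 < Fintype.card K ^ (k + 1) := Nat.one_lt_pow (by omega) hq
    by_cases hcase : ∀ u : Fin (k + 2) → K, u ≠ 0 → ∀ B : Matrix (Fin (k + 2)) (Fin (k + 1)) K,
        ∀ A : Matrix (Fin (k + 1)) (Fin (k + 2)) K, A * B = 1 → (∀ y, u ⬝ᵥ B.mulVec y = 0) →
        (∀ x, u ⬝ᵥ x = 0 → ∃ y, B.mulVec y = x) → ∀ u' : Fin (k + 1) → K, u' ≠ 0 →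
        ∃ y, u' ⬝ᵥ y = 0 ∧ eval y (pullback B F) ≠ 0
    · have hdc := mul_ncard_mul_le_of_incidence
        (fun (x : Fin (k + 2) → K) (u : Fin (k + 2) → K) => u ⬝ᵥ x = 0)
        {x : Fin (k + 2) → K | x ≠ 0 ∧ eval x F = 0} {0}ᶜ
        (t := Fintype.card K ^ 2) (c := Fintype.card K ^ (k + 1) - 1)
        (M := e * (Fintype.card K - 1) * (Fintype.card K ^ (k + 1) - 1)) ?_ ?_
      · have h1 : ({0}ᶜ : Set (Fin (k + 2) → K)).ncard = Fintype.card K ^ (k + 2) - 1 := by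
          rw [Set.ncard_compl, Set.ncard_singleton]
          simp
        rw [h1] at hdc
        have h2 : Fintype.card K ^ 2 * {x : Fin (k + 2) → K | x ≠ 0 ∧ eval x F = 0}.ncard ≤
            e * (Fintype.card K - 1) * (Fintype.card K ^ (k + 2) - 1) := by
          refine Nat.le_of_mul_le_mul_right (c := Fintype.card K ^ (k + 1) - 1) ?_ (by omega)
          calc _ = _ := by ring
            _ ≤ _ := hdc
            _ = _ := by ring
        have h3 : 1 ≤ Fintype.card K ^ (k + 2) := Nat.one_le_pow _ _ (by omega)
        have h4 := Nat.mul_le_mul_left (e * (Fintype.card K - 1)) h3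
        rw [Nat.mul_sub] at h2
        rw [mul_one] at h2 h4
        change _ ≤ e * (Fintype.card K - 1) * Fintype.card K ^ (k + 2)
        change Fintype.card K ^ 2 *
          {x : Fin (k + 2) → K | x ≠ 0 ∧ eval x F = 0}.ncard + _ ≤ _
        omega
      · rintro x ⟨hx0, -⟩
        exact (ncard_hyperplane_ne_zero hx0).ge
      · intro u hu
        obtain ⟨B, A, hAB, h1, h2⟩ := exists_hyperplane_parametrization (u := u) hu
        have h3 := ih (isHomogeneous_pullback B hF) he1 he (hcase u hu B A hAB h1 h2)
        have h4 : {x | x ∈ {x : Fin (k + 2) → K | x ≠ 0 ∧ eval x F = 0} ∧ u ⬝ᵥ x = 0}.ncard ≤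
            {y | y ≠ 0 ∧ eval y (pullback B F) = 0}.ncard := by
          refine (ncard_image_mulVec_le (B := B) _ fun x hx => h2 x hx.2).trans
            (Set.ncard_le_ncard ?_)
          rintro y ⟨⟨hy0, hy⟩, -⟩
          refine ⟨?_, by rwa [eval_pullback]⟩
          rintro rfl
          exact hy0 (Matrix.mulVec_zero B)
        have h5 := Nat.mul_le_mul_left (Fintype.card K ^ 2) h4
        rw [Nat.mul_sub, mul_one]
        omega
    · push Not at hcase
      obtain ⟨u, hu, B, A, hAB, h1, hB, u', hu', h2⟩ := hcase
      have hvec : ∀ y, Matrix.vecMul u' A ⬝ᵥ B.mulVec y = u' ⬝ᵥ y := by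
        intro y
        rw [← Matrix.dotProduct_mulVec, Matrix.mulVec_mulVec, hAB, Matrix.one_mulVec]
      have h3 := card_zeros_le_of_vanish_codim_two hF he hyp (a := u) (b := Matrix.vecMul u' A)
        ?_ ?_ ?_
      · set v := {x : Fin (k + 2) → K | x ≠ 0 ∧ eval x F = 0}.ncard with hv
        change Fintype.card K ^ 2 * v + e * (Fintype.card K - 1) ≤
          e * (Fintype.card K - 1) * Fintype.card K ^ (k + 2)
        generalize Fintype.card K = q at *
        obtain ⟨e, rfl⟩ : ∃ e', e = e' + 1 := ⟨e - 1, by omega⟩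
        obtain ⟨s, rfl⟩ : ∃ s, q = e + 2 + s := ⟨q - (e + 2), by omega⟩
        have h4 : e + 2 + s - 1 = e + 1 + s := by omega
        rw [h4, Nat.add_sub_cancel] at h3
        rw [h4]
        have h5 := Nat.mul_le_mul_left (e + 2 + s) h3
        have h6 : (e + 2 + s) + e * (e + 1 + s) ≤ (e + 1 + s) * (e + 2 + s) := by nlinarith
        have h7 := Nat.mul_le_mul_right ((e + 2 + s) ^ (k + 1)) h6
        have h8 : (e + 1) * (e + 1 + s) ≤ (e + 2 + s) ^ 2 := by nlinarith
        have h9 : (e + 2 + s) ^ (k + 1) = (e + 2 + s) * (e + 2 + s) ^ k := pow_succ' _ _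
        have h10 : (e + 2 + s) ^ (k + 2) = (e + 2 + s) * (e + 2 + s) ^ (k + 1) := pow_succ' _ _
        rw [h10]
        rw [h9] at h5 h7 ⊢
        clear_value v
        clear h3 h4 h9 h10
        generalize (e + 2 + s) ^ k = Q at *
        generalize e + 1 + s = c at *
        generalize e + 2 + s = q at *
        ring_nf at h5 h7 h8 ⊢
        linarith
      · intro α β hαβ
        have hβ : β = 0 := by
          by_contra hβ
          apply hu'
          apply dotProduct_eq_zero
          intro y
          have h4 := congrArg (fun c => c ⬝ᵥ B.mulVec y) hαβ
          simpa [add_dotProduct, smul_dotProduct, h1, hvec, hβ] using h4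
        refine ⟨?_, hβ⟩
        simpa [hβ, hu] using hαβ
      · intro x hx hx'
        obtain ⟨y, rfl⟩ := hB x hx
        rw [← eval_pullback]
        exact h2 y (by rwa [hvec] at hx')
      · rw [← ncard_hyperplane hu']
        refine (ncard_image_mulVec_le (B := B) _ fun x hx => hB x hx.1).trans
          (Set.ncard_le_ncard ?_)
        rintro y ⟨-, hy⟩
        rwa [hvec] at hy

end NoLinearFactor

section Systems

variable {K : Type*} [Field K]

lemma ncard_common_zeros_linear [Fintype K] {n r : ℕ} {u : Fin r → Fin n → K}
    (hu : LinearIndependent K u) :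
    {x : Fin n → K | ∀ i, u i ⬝ᵥ x = 0}.ncard = Fintype.card K ^ (n - r) := by
  classical
  set M : Matrix (Fin r) (Fin n) K := Matrix.of u with hM
  have h1 : M.rank = r := by
    have := LinearIndependent.rank_matrix (M := M) hu
    simpa using this
  have h2 := M.mulVecLin.finrank_range_add_finrank_ker
  rw [Module.finrank_fin_fun, ← Matrix.rank, h1] at h2
  have h3 : {x : Fin n → K | ∀ i, u i ⬝ᵥ x = 0} =
      (LinearMap.ker M.mulVecLin : Set (Fin n → K)) := by
    ext x
    simp only [Set.mem_ofPred_eq, SetLike.mem_coe, LinearMap.mem_ker, Matrix.mulVecLin_apply]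
    exact funext_iff.symm
  rw [h3, ← Nat.card_coe_set_eq, SetLike.coe_sort_coe,
    Module.natCard_eq_pow_finrank (K := K), Nat.card_eq_fintype_card]
  congr 1
  omega

lemma exists_linForm_family {n r : ℕ} {W : Fin r → MvPolynomial (Fin n) K}
    (hW : LinearIndependent K W) (hh : ∀ i, (W i).IsHomogeneous 1) :
    ∃ u : Fin r → Fin n → K, LinearIndependent K u ∧ ∀ i, W i = linForm (u i) := by
  choose u hu using fun i => exists_eq_linForm_of_isHomogeneous_one (hh i)
  refine ⟨u, LinearIndependent.of_comp
    (Fintype.linearCombination K (X : Fin n → MvPolynomial (Fin n) K)) ?_, hu⟩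
  have h1 : Fintype.linearCombination K (X : Fin n → MvPolynomial (Fin n) K) ∘ u = W := by
    ext i : 1
    simp [hu, linForm, Fintype.linearCombination_apply, smul_eq_C_mul]
  rw [h1]
  exact hW

lemma ncard_linear_off_hyperplane_le [Fintype K] {m r : ℕ} {u : Fin r → Fin (m + 1) → K}
    (hu : LinearIndependent K u) (w : Fin (m + 1) → K) :
    {x : Fin (m + 1) → K | (∀ i, u i ⬝ᵥ x = 0) ∧ w ⬝ᵥ x ≠ 0}.ncard ≤
      (Fintype.card K - 1) * flq (Fintype.card K) m r := by
  by_cases hw : w ∈ Submodule.span K (Set.range u)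
  · have h1 : {x : Fin (m + 1) → K | (∀ i, u i ⬝ᵥ x = 0) ∧ w ⬝ᵥ x ≠ 0} = ∅ := by
      rw [Set.eq_empty_iff_forall_notMem]
      rintro x ⟨hx, hwx⟩
      apply hwx
      obtain ⟨c, rfl⟩ := (Submodule.mem_span_range_iff_exists_fun K).1 hw
      rw [sum_dotProduct]
      exact Finset.sum_eq_zero fun i _ => by rw [smul_dotProduct, hx, smul_zero]
    rw [h1, Set.ncard_empty]
    exact Nat.zero_le _
  · have h1 : LinearIndependent K (Fin.cons w u : Fin (r + 1) → Fin (m + 1) → K) :=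
      linearIndependent_finCons.2 ⟨hu, hw⟩
    have h2 : r + 1 ≤ m + 1 := by simpa using h1.fintype_card_le_finrank
    have h3 := ncard_common_zeros_linear h1
    have h4 := ncard_common_zeros_linear hu
    have h5 : {x : Fin (m + 1) → K | (∀ i, u i ⬝ᵥ x = 0) ∧ w ⬝ᵥ x ≠ 0} =
        {x | ∀ i, u i ⬝ᵥ x = 0} \
          {x | ∀ i, (Fin.cons w u : Fin (r + 1) → Fin (m + 1) → K) i ⬝ᵥ x = 0} := by
      ext x
      simp only [Set.mem_ofPred_eq, Set.mem_sdiff, Fin.forall_fin_succ, Fin.cons_zero,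
        Fin.cons_succ]
      tauto
    rw [h5, Set.ncard_sdiff ?_, h3, h4, flq, if_pos (by omega),
      show m + 1 - r = (m - r) + 1 by omega, show m + 1 - (r + 1) = m - r by omega, pow_succ']
    · rw [Nat.sub_mul, one_mul]
    · intro x hx i
      exact hx i.succ

lemma one_le_degree_of_irreducible {σ : Type*} {P : MvPolynomial σ K} {e : ℕ} (hP : Irreducible P)
    (he : P.IsHomogeneous e) : 1 ≤ e := by
  by_contra! h
  obtain rfl : e = 0 := by omega
  have h1 := totalDegree_eq_zero_iff_eq_C.1 (Nat.le_zero.1 he.totalDegree_le)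
  have h0 := hP.ne_zero
  rw [h1] at h0
  refine hP.not_isUnit ?_
  rw [h1]
  exact (isUnit_iff_ne_zero.2 fun h2 => h0 (by rw [h2, C_0])).map C

/-- Division of a system of forms by a common factor. -/
lemma exists_system_quotient {σ : Type*} {r d : ℕ} (hr : 1 ≤ r) {W : Fin r → MvPolynomial σ K}
    (hW : LinearIndependent K W) (hh : ∀ i, (W i).IsHomogeneous d) {P : MvPolynomial σ K}
    (hP : ∀ i, P ∣ W i) :
    ∃ e f W', e + f = d ∧ P.IsHomogeneous e ∧ LinearIndependent K W' ∧
      (∀ i, (W' i).IsHomogeneous f) ∧ ∀ i, W i = P * W' i := by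
  choose W' hW' using hP
  have h0 : ∀ i, P * W' i ≠ 0 := fun i => hW' i ▸ hW.ne_zero i
  obtain ⟨e, f, hef, he, -⟩ := exists_isHomogeneous_of_mul (hW' ⟨0, hr⟩ ▸ hh _) (h0 ⟨0, hr⟩)
  refine ⟨e, f, W', hef, he, ?_, fun i => ?_, hW'⟩
  · refine LinearIndependent.of_comp (LinearMap.mulLeft K P) ?_
    have h1 : LinearMap.mulLeft K P ∘ W' = W := by
      ext i : 1
      simp [hW']
    rw [h1]
    exact hW
  · obtain ⟨a, b, hab, ha, hb⟩ := exists_isHomogeneous_of_mul (hW' i ▸ hh i) (h0 i)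
    have := ha.inj_right he (left_ne_zero_of_mul (h0 i))
    obtain rfl : b = f := by omega
    exact hb

lemma one_le_degree_of_linearIndependent {σ : Type*} {r d : ℕ} (hr : 2 ≤ r)
    {W : Fin r → MvPolynomial σ K} (hW : LinearIndependent K W)
    (hh : ∀ i, (W i).IsHomogeneous d) : 1 ≤ d := by
  by_contra! h
  obtain rfl : d = 0 := by omega
  have h1 : ∀ i, W i = C ((W i).coeff 0) := fun i =>
    totalDegree_eq_zero_iff_eq_C.1 (Nat.le_zero.1 (hh i).totalDegree_le)
  have h2 : LinearIndependent K fun i => (W i).coeff 0 := by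
    refine LinearIndependent.of_comp (Algebra.linearMap K (MvPolynomial σ K)) ?_
    have h2 : (Algebra.linearMap K (MvPolynomial σ K) ∘ fun i => (W i).coeff 0) = W := by
      ext i : 1
      simp only [Function.comp_apply, Algebra.linearMap_apply, algebraMap_eq]
      exact (h1 i).symm
    rw [h2]
    exact hW
  have h3 := h2.fintype_card_le_finrank
  simp at h3
  omega

lemma card_common_zeros_coprime_system_le [Fintype K] {k r d : ℕ} (hr : 1 ≤ r)
    {W : Fin r → MvPolynomial (Fin (k + 2)) K} (hW : LinearIndependent K W)
    (hh : ∀ i, (W i).IsHomogeneous d) (hd : d + 1 ≤ Fintype.card K)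
    (hco : ∀ P, Irreducible P → ∃ i, ¬ P ∣ W i) :
    {x : Fin (k + 2) → K | x ≠ 0 ∧ ∀ i, eval x (W i) = 0}.ncard + d * d ≤
      d * d * Fintype.card K ^ k := by
  have h1 := card_common_zeros_coprime_le hh (W ⟨0, hr⟩) d (hW.ne_zero _) (hh _) hd
    fun P hP _ => hco P hP
  rw [pow_succ', mul_left_comm] at h1
  have h2 := Nat.le_of_mul_le_mul_left h1 Fintype.card_pos
  refine le_trans (Nat.add_le_add_right (Set.ncard_le_ncard ?_) _) h2
  exact fun x hx => ⟨hx.1, hx.2 _, hx.2⟩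

/-- The number of common zeros outside a hyperplane. -/
theorem card_common_zeros_off_hyperplane_le [Fintype K] {k r : ℕ} (hr : 1 ≤ r)
    {u : Fin (k + 2) → K} (hu : u ≠ 0) (d : ℕ) : ∀ W : Fin r → MvPolynomial (Fin (k + 2)) K,
    LinearIndependent K W → (∀ i, (W i).IsHomogeneous d) → 1 ≤ d → d + 3 ≤ Fintype.card K →
    {x : Fin (k + 2) → K | (∀ i, eval x (W i) = 0) ∧ u ⬝ᵥ x ≠ 0}.ncard ≤
      (Fintype.card K - 1) *
        ((d - 1) * Fintype.card K ^ k + flq (Fintype.card K) (k + 1) r) := by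
  have hq : 1 < Fintype.card K := Fintype.one_lt_card
  have hform : ∀ {e : ℕ} {F : MvPolynomial (Fin (k + 2)) K}, F ≠ 0 → F.IsHomogeneous e →
      e + 1 ≤ Fintype.card K → {x : Fin (k + 2) → K | eval x F = 0 ∧ u ⬝ᵥ x ≠ 0}.ncard ≤
        e * (Fintype.card K - 1) * Fintype.card K ^ k := by
    intro e F hF0 hF he
    have h1 := card_zeros_off_hyperplane_le hF0 hF he hu
    rw [pow_succ', mul_left_comm] at h1
    exact Nat.le_of_mul_le_mul_left h1 Fintype.card_pos
  induction d using Nat.strong_induction_on with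
  | _ d ih =>
  intro W hW hh hd hdq
  obtain rfl | hr2 : r = 1 ∨ 2 ≤ r := by omega
  · have h1 := hform (hW.ne_zero 0) (hh 0) (by omega)
    obtain ⟨d, rfl⟩ : ∃ d', d = d' + 1 := ⟨d - 1, by omega⟩
    rw [flq, if_pos (by omega)]
    simp only [Nat.add_sub_cancel]
    have h2 : {x : Fin (k + 2) → K | (∀ i, eval x (W i) = 0) ∧ u ⬝ᵥ x ≠ 0} ⊆
        {x | eval x (W 0) = 0 ∧ u ⬝ᵥ x ≠ 0} := fun x hx => ⟨hx.1 0, hx.2⟩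
    refine ((Set.ncard_le_ncard h2).trans h1).trans (le_of_eq ?_)
    ring
  by_cases hco : ∃ P, Irreducible P ∧ ∀ i, P ∣ W i
  · obtain ⟨P, hP, hPW⟩ := hco
    obtain ⟨e, f, W', rfl, he, hW', hh', hPW'⟩ := exists_system_quotient hr hW hh hPW
    have he1 := one_le_degree_of_irreducible hP he
    have hf1 := one_le_degree_of_linearIndependent hr2 hW' hh'
    have h1 := hform hP.ne_zero he (by omega)
    have h2 := ih f (by omega) W' hW' hh' hf1 (by omega)
    have h3 : {x : Fin (k + 2) → K | (∀ i, eval x (W i) = 0) ∧ u ⬝ᵥ x ≠ 0}.ncard ≤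
        {x : Fin (k + 2) → K | eval x P = 0 ∧ u ⬝ᵥ x ≠ 0}.ncard +
        {x : Fin (k + 2) → K | (∀ i, eval x (W' i) = 0) ∧ u ⬝ᵥ x ≠ 0}.ncard := by
      refine le_trans (Set.ncard_le_ncard ?_) (Set.ncard_union_le _ _)
      rintro x ⟨hx1, hx2⟩
      by_cases hx : eval x P = 0
      · exact Or.inl ⟨hx, hx2⟩
      · refine Or.inr ⟨fun i => ?_, hx2⟩
        have h4 := hx1 i
        rw [hPW', map_mul, mul_eq_zero] at h4
        exact h4.resolve_left hx
    obtain ⟨f, rfl⟩ : ∃ f', f = f' + 1 := ⟨f - 1, by omega⟩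
    rw [← add_assoc]
    simp only [Nat.add_sub_cancel] at h2 ⊢
    refine (h3.trans (Nat.add_le_add h1 h2)).trans (le_of_eq ?_)
    ring
  · push Not at hco
    obtain rfl | hd2 : d = 1 ∨ 2 ≤ d := by omega
    · obtain ⟨v, hv, hWv⟩ := exists_linForm_family hW hh
      have h1 := ncard_linear_off_hyperplane_le hv u
      simpa [hWv, eval_linForm] using h1
    · have h1 := card_common_zeros_coprime_system_le hr hW hh (by omega) hco
      have h2 : {x : Fin (k + 2) → K | (∀ i, eval x (W i) = 0) ∧ u ⬝ᵥ x ≠ 0}.ncard ≤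
          {x : Fin (k + 2) → K | x ≠ 0 ∧ ∀ i, eval x (W i) = 0}.ncard := by
        refine Set.ncard_le_ncard ?_
        rintro x ⟨hx1, hx2⟩
        refine ⟨?_, hx1⟩
        rintro rfl
        exact hx2 (dotProduct_zero u)
      have h3 : d * d ≤ (Fintype.card K - 1) * (d - 1) := by
        obtain ⟨d, rfl⟩ : ∃ d', d = d' + 2 := ⟨d - 2, by omega⟩
        calc (d + 2) * (d + 2) ≤ (d + 4) * (d + 1) := by nlinarith
          _ ≤ _ := Nat.mul_le_mul (by omega) (by omega)
      have h4 := Nat.mul_le_mul_right (Fintype.card K ^ k) h3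
      calc _ ≤ (Fintype.card K - 1) * (d - 1) * Fintype.card K ^ k := by omega
        _ = (Fintype.card K - 1) * ((d - 1) * Fintype.card K ^ k) := by ring
        _ ≤ _ := Nat.mul_le_mul_left _ (Nat.le_add_right _ _)

lemma card_zeros_lt_of_no_linear_factor [Fintype K] {k e : ℕ}
    {F : MvPolynomial (Fin (k + 2)) K} (hF : F.IsHomogeneous e) (he1 : 1 ≤ e)
    (he : e + 1 ≤ Fintype.card K) (hL : ∀ u : Fin (k + 2) → K, u ≠ 0 → ¬ linForm u ∣ F) :
    {x : Fin (k + 2) → K | x ≠ 0 ∧ eval x F = 0}.ncard <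
      e * (Fintype.card K - 1) * Fintype.card K ^ k := by
  have hq : 1 < Fintype.card K := Fintype.one_lt_card
  have h1 := card_zeros_le_of_no_hyperplane (k + 2) hF he1 he fun u hu => by
    by_contra! h
    exact hL u hu (linForm_dvd_of_forall_eval_eq_zero hF (by omega) hu h)
  have h2 : 0 < e * (Fintype.card K - 1) := Nat.mul_pos he1 (by omega)
  refine Nat.lt_of_mul_lt_mul_left (a := Fintype.card K ^ 2) ?_
  calc _ < _ := Nat.lt_add_of_pos_right h2
    _ ≤ _ := h1
    _ = _ := by ring

/-- The number of common zeros of a system of at least two forms without common linear factor. -/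
theorem card_common_zeros_le_of_no_linear_factor [Fintype K] {k r : ℕ} (hr : 2 ≤ r) (d : ℕ) :
    ∀ W : Fin r → MvPolynomial (Fin (k + 2)) K,
    LinearIndependent K W → (∀ i, (W i).IsHomogeneous d) → d + 2 ≤ Fintype.card K →
    (∀ u : Fin (k + 2) → K, u ≠ 0 → ¬ ∀ i, linForm u ∣ W i) →
    {x : Fin (k + 2) → K | x ≠ 0 ∧ ∀ i, eval x (W i) = 0}.ncard + (if d = 1 then 1 else 2) ≤
      (Fintype.card K - 1) * (d - 1) * Fintype.card K ^ k + Fintype.card K ^ k := by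
  have hq : 1 < Fintype.card K := Fintype.one_lt_card
  induction d using Nat.strong_induction_on with
  | _ d ih =>
  intro W hW hh hdq hL
  have hd := one_le_degree_of_linearIndependent hr hW hh
  by_cases hco : ∃ P, Irreducible P ∧ ∀ i, P ∣ W i
  · obtain ⟨P, hP, hPW⟩ := hco
    obtain ⟨e, f, W', rfl, he, hW', hh', hPW'⟩ := exists_system_quotient (by omega) hW hh hPW
    have he1 := one_le_degree_of_irreducible hP he
    have hf1 := one_le_degree_of_linearIndependent hr hW' hh'
    have h1 := card_zeros_lt_of_no_linear_factor he he1 (by omega)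
      fun u hu h => hL u hu fun i => h.trans (hPW i)
    have h2 := ih f (by omega) W' hW' hh' (by omega)
      fun u hu h => hL u hu fun i => (h i).trans (hPW' i ▸ dvd_mul_left _ _)
    have h3 : {x : Fin (k + 2) → K | x ≠ 0 ∧ ∀ i, eval x (W i) = 0}.ncard ≤
        {x : Fin (k + 2) → K | x ≠ 0 ∧ eval x P = 0}.ncard +
        {x : Fin (k + 2) → K | x ≠ 0 ∧ ∀ i, eval x (W' i) = 0}.ncard := by
      refine le_trans (Set.ncard_le_ncard ?_) (Set.ncard_union_le _ _)
      rintro x ⟨hx1, hx2⟩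
      by_cases hx : eval x P = 0
      · exact Or.inl ⟨hx1, hx⟩
      · refine Or.inr ⟨hx1, fun i => ?_⟩
        have h4 := hx2 i
        rw [hPW', map_mul, mul_eq_zero] at h4
        exact h4.resolve_left hx
    rw [if_neg (by omega)]
    obtain ⟨f, rfl⟩ : ∃ f', f = f' + 1 := ⟨f - 1, by omega⟩
    rw [← add_assoc]
    simp only [Nat.add_sub_cancel] at h2 ⊢
    have h5 : (Fintype.card K - 1) * (e + f) * Fintype.card K ^ k =
      e * (Fintype.card K - 1) * Fintype.card K ^ k +
        (Fintype.card K - 1) * f * Fintype.card K ^ k := by ring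
    split_ifs at h2 <;> omega
  · push Not at hco
    obtain rfl | hd2 : d = 1 ∨ 2 ≤ d := by omega
    · obtain ⟨v, hv, hWv⟩ := exists_linForm_family hW hh
      have h1 := ncard_common_zeros_linear hv
      have h2 : {x : Fin (k + 2) → K | x ≠ 0 ∧ ∀ i, eval x (W i) = 0} =
          {x | ∀ i, v i ⬝ᵥ x = 0} \ {0} := by
        ext x
        simp [hWv, eval_linForm, and_comm]
      rw [h2, Set.ncard_sdiff_singleton_of_mem (by simp), h1, if_pos rfl,
        Nat.sub_add_cancel (Nat.one_le_pow _ _ (by omega))]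
      refine (Nat.pow_le_pow_right (by omega) (by omega)).trans (Nat.le_add_left _ _)
    · have h1 := card_common_zeros_coprime_system_le (by omega) hW hh (by omega) hco
      rw [if_neg (by omega)]
      have h3 : d * d ≤ (Fintype.card K - 1) * (d - 1) + 1 := by
        obtain ⟨d, rfl⟩ : ∃ d', d = d' + 2 := ⟨d - 2, by omega⟩
        calc (d + 2) * (d + 2) ≤ (d + 3) * (d + 1) + 1 := by nlinarith
          _ ≤ _ := Nat.add_le_add_right (Nat.mul_le_mul (by omega) (by omega)) _
      have h4 := Nat.mul_le_mul_right (Fintype.card K ^ k) h3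
      rw [add_mul, one_mul] at h4
      have h5 : 4 ≤ d * d := Nat.mul_le_mul hd2 hd2
      omega

/-- The number of nontrivial common zeros of a system of forms of degree at least two. -/
theorem card_common_zeros_le [Fintype K] {k r d : ℕ} (hr : 1 ≤ r)
    {W : Fin r → MvPolynomial (Fin (k + 2)) K} (hW : LinearIndependent K W)
    (hh : ∀ i, (W i).IsHomogeneous d) (hd : 2 ≤ d) (hdq : d + 2 ≤ Fintype.card K) :
    {x : Fin (k + 2) → K | x ≠ 0 ∧ ∀ i, eval x (W i) = 0}.ncard + 1 ≤
      (Fintype.card K - 1) * (d - 1) * Fintype.card K ^ k + Fintype.card K ^ k +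
        (Fintype.card K - 1) * flq (Fintype.card K) (k + 1) r ∧
    ({x : Fin (k + 2) → K | x ≠ 0 ∧ ∀ i, eval x (W i) = 0}.ncard + 1 =
      (Fintype.card K - 1) * (d - 1) * Fintype.card K ^ k + Fintype.card K ^ k +
        (Fintype.card K - 1) * flq (Fintype.card K) (k + 1) r →
      ∃ u : Fin (k + 2) → K, u ≠ 0 ∧ ∀ i, linForm u ∣ W i) := by
  have hq : 1 < Fintype.card K := Fintype.one_lt_card
  have hqk : 1 ≤ Fintype.card K ^ k := Nat.one_le_pow _ _ (by omega)
  by_cases hL : ∃ u : Fin (k + 2) → K, u ≠ 0 ∧ ∀ i, linForm u ∣ W i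
  · refine ⟨?_, fun _ => hL⟩
    obtain ⟨u, hu, hLW⟩ := hL
    obtain ⟨e, f, W', rfl, he, hW', hh', hPW'⟩ := exists_system_quotient hr hW hh hLW
    obtain rfl : e = 1 := he.inj_right (isHomogeneous_linForm u) (linForm_ne_zero hu)
    have h1 := card_common_zeros_off_hyperplane_le hr hu f W' hW' hh' (by omega) (by omega)
    have h2 := ncard_hyperplane hu
    have h3 : {x : Fin (k + 2) → K | x ≠ 0 ∧ ∀ i, eval x (W i) = 0}.ncard + 1 ≤
        {x : Fin (k + 2) → K | u ⬝ᵥ x = 0}.ncard +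
        {x : Fin (k + 2) → K | (∀ i, eval x (W' i) = 0) ∧ u ⬝ᵥ x ≠ 0}.ncard := by
      rw [← Set.ncard_insert_of_notMem (a := (0 : Fin (k + 2) → K)) (by simp)]
      refine le_trans (Set.ncard_le_ncard ?_) (Set.ncard_union_le _ _)
      intro x hx
      by_cases hux : u ⬝ᵥ x = 0
      · exact Or.inl hux
      · refine Or.inr ⟨fun i => ?_, hux⟩
        rcases hx with rfl | hx
        · simp at hux
        · have h4 := hx.2 i
          rw [hPW', map_mul, eval_linForm, mul_eq_zero] at h4
          exact h4.resolve_left hux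
    obtain ⟨f, rfl⟩ : ∃ f', f = f' + 1 := ⟨f - 1, by omega⟩
    obtain ⟨s, hs⟩ : ∃ s, Fintype.card K = s + 1 := ⟨Fintype.card K - 1, by omega⟩
    rw [show 1 + (f + 1) - 1 = f + 1 by omega]
    rw [hs] at h1 h2 ⊢
    simp only [Nat.add_sub_cancel] at h1 ⊢
    rw [h2] at h3
    calc _ ≤ (s + 1) ^ (k + 1) + s * (f * (s + 1) ^ k + flq (s + 1) (k + 1) r) :=
        h3.trans (Nat.add_le_add_left h1 _)
      _ = _ := by ring
  · suffices h : {x : Fin (k + 2) → K | x ≠ 0 ∧ ∀ i, eval x (W i) = 0}.ncard + 1 <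
      (Fintype.card K - 1) * (d - 1) * Fintype.card K ^ k + Fintype.card K ^ k +
        (Fintype.card K - 1) * flq (Fintype.card K) (k + 1) r from
      ⟨h.le, fun h1 => absurd h1 h.ne⟩
    push Not at hL
    obtain rfl | hr2 : r = 1 ∨ 2 ≤ r := by omega
    · have h1 := card_zeros_lt_of_no_linear_factor (hh 0) (by omega) (by omega) fun u hu h => by
        obtain ⟨i, hi⟩ := hL u hu
        exact hi (Fin.eq_zero i ▸ h)
      have h2 : {x : Fin (k + 2) → K | x ≠ 0 ∧ ∀ i, eval x (W i) = 0} ⊆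
        {x | x ≠ 0 ∧ eval x (W 0) = 0} := fun x hx => ⟨hx.1, hx.2 0⟩
      have h4 := Set.ncard_le_ncard h2
      rw [flq, if_pos (by omega), Nat.add_sub_cancel]
      obtain ⟨d, rfl⟩ : ∃ d', d = d' + 1 := ⟨d - 1, by omega⟩
      rw [Nat.add_sub_cancel]
      have h3 : (d + 1) * (Fintype.card K - 1) * Fintype.card K ^ k =
        (Fintype.card K - 1) * d * Fintype.card K ^ k +
          (Fintype.card K - 1) * Fintype.card K ^ k := by ring
      omega
    · have h1 := card_common_zeros_le_of_no_linear_factor hr2 d W hW hh hdq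
        fun u hu h => by
          obtain ⟨i, hi⟩ := hL u hu
          exact hi (h i)
      rw [if_neg (by omega)] at h1
      omega

end Systems

section Projective

lemma pp_sub_one (q n : ℕ) : pp q ((n : ℤ) - 1) = ∑ i ∈ Finset.range n, q ^ i := by
  obtain _ | n := n
  · simp [pp]
  · rw [pp, if_neg (by omega)]
    congr 2
    omega

lemma mul_pp_sub_one_add_one {q : ℕ} (hq : 1 ≤ q) (n : ℕ) :
    (q - 1) * pp q ((n : ℤ) - 1) + 1 = q ^ n := by
  obtain ⟨s, rfl⟩ : ∃ s, q = s + 1 := ⟨q - 1, by omega⟩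
  rw [pp_sub_one, Nat.add_sub_cancel, mul_comm, geom_sum_mul_add]

lemma mul_Tbound_add_one {q d : ℕ} (hq : 1 ≤ q) (hd : 2 ≤ d) (k r : ℕ) :
    (q - 1) * Tbound q d (k + 1) r + 1 =
      (q - 1) * (d - 1) * q ^ k + q ^ k + (q - 1) * flq q (k + 1) r := by
  have h1 := mul_pp_sub_one_add_one hq k
  rw [Tbound, if_neg (by omega), Nat.add_sub_cancel,
    show ((k + 1 : ℕ) : ℤ) - 2 = (k : ℤ) - 1 by omega]
  calc _ = (q - 1) * (d - 1) * q ^ k + ((q - 1) * pp q ((k : ℤ) - 1) + 1) +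
        (q - 1) * flq q (k + 1) r := by ring
    _ = _ := by rw [h1]

lemma mul_Tbound_one_add_one {q m r : ℕ} (hq : 1 ≤ q) (hr : r ≤ m + 1) :
    (q - 1) * Tbound q 1 m r + 1 = q ^ (m + 1 - r) := by
  rw [Tbound, if_pos rfl, ← mul_pp_sub_one_add_one hq (m + 1 - r)]
  congr 3
  omega

variable {K : Type*} [Field K]

/-- A projective set has `|K| - 1` times fewer points than the cone over it without apex. -/
lemma mul_ncard_projectivization [Fintype K] {n : ℕ} (p : (Fin n → K) → Prop)
    (hp : ∀ (a : Kˣ) x, p (a • x) ↔ p x) :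
    (Fintype.card K - 1) * {x : Projectivization K (Fin n → K) | p x.rep}.ncard =
      {x | x ≠ 0 ∧ p x}.ncard := by
  have h1 : {x | x ≠ 0 ∧ p x} = (fun y : Projectivization K (Fin n → K) × Kˣ => y.2 • y.1.rep) ''
      ({x : Projectivization K (Fin n → K) | p x.rep} ×ˢ Set.univ) := by
    ext x
    constructor
    · rintro ⟨hx, hpx⟩
      obtain ⟨a, ha⟩ := Projectivization.exists_smul_eq_mk_rep K x hx
      refine ⟨(Projectivization.mk K x hx, a⁻¹), ⟨?_, trivial⟩, ?_⟩
      · change p _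
        rw [← ha, hp]
        exact hpx
      · change a⁻¹ • _ = x
        rw [← ha, inv_smul_smul]
    · rintro ⟨⟨y, a⟩, ⟨hy, -⟩, rfl⟩
      exact ⟨(smul_ne_zero_iff_ne a).2 y.rep_nonzero, (hp _ _).2 hy⟩
  rw [h1, Set.ncard_image_of_injective, Set.ncard_prod, Set.ncard_univ, Nat.card_units,
    Nat.card_eq_fintype_card, mul_comm]
  rintro ⟨x, a⟩ ⟨y, b⟩ hxy
  change a • x.rep = b • y.rep at hxy
  have h2 : x = y := by
    rw [← x.mk_rep, ← y.mk_rep, Projectivization.mk_eq_mk_iff]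
    exact ⟨a⁻¹ * b, by rw [mul_smul, ← hxy, inv_smul_smul]⟩
  subst h2
  obtain ⟨i, hi⟩ := Function.ne_iff.1 x.rep_nonzero
  have h3 := congrFun hxy i
  simp only [Pi.smul_apply, Units.smul_def, smul_eq_mul] at h3
  rw [Prod.mk.injEq]
  exact ⟨rfl, Units.ext (mul_right_cancel₀ hi h3)⟩

lemma mul_ncard_projective_zeros [Fintype K] {n r d : ℕ} {W : Fin r → MvPolynomial (Fin n) K}
    (hh : ∀ i, (W i).IsHomogeneous d) :
    (Fintype.card K - 1) *
        {x : Projectivization K (Fin n → K) | ∀ i, eval x.rep (W i) = 0}.ncard =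
      {x | x ≠ 0 ∧ ∀ i, eval x (W i) = 0}.ncard := by
  refine mul_ncard_projectivization (fun x => ∀ i, eval x (W i) = 0) fun a x => ?_
  refine forall_congr' fun i => ?_
  rw [Units.smul_def, eval_smul_of_isHomogeneous (hh i)]
  simp

lemma ncard_zeros_eq_Tbound_one [Fintype K] {m r : ℕ} {W : Fin r → MvPolynomial (Fin (m + 1)) K}
    (hW : LinearIndependent K W) (hh : ∀ i, (W i).IsHomogeneous 1) :
    {x : Projectivization K (Fin (m + 1) → K) | ∀ i, eval x.rep (W i) = 0}.ncard =
      Tbound (Fintype.card K) 1 m r := by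
  have hq : 1 < Fintype.card K := Fintype.one_lt_card
  obtain ⟨v, hv, hWv⟩ := exists_linForm_family hW hh
  have hr : r ≤ m + 1 := by simpa using hv.fintype_card_le_finrank
  have h1 := mul_ncard_projective_zeros hh
  have h2 : {x : Fin (m + 1) → K | x ≠ 0 ∧ ∀ i, eval x (W i) = 0} =
      {x | ∀ i, v i ⬝ᵥ x = 0} \ {0} := by
    ext x
    simp [hWv, eval_linForm, and_comm]
  rw [h2, Set.ncard_sdiff_singleton_of_mem (by simp), ncard_common_zeros_linear hv,
    ← mul_Tbound_one_add_one (by omega) hr, Nat.add_sub_cancel] at h1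
  exact Nat.eq_of_mul_eq_mul_left (by omega) h1

end Projective

section Attainment

lemma ncard_eq_sum_cons_head {K : Type*} [Fintype K] {n : ℕ} (S : Set (Fin (n + 1) → K)) :
    S.ncard = ∑ a : K, {y : Fin n → K | (Fin.cons a y : Fin (n + 1) → K) ∈ S}.ncard := by
  classical
  rw [ncard_eq_sum_ite, ← (Fin.consEquiv fun _ => K).sum_comp, Fintype.sum_prod_type]
  refine Finset.sum_congr rfl fun a _ => ?_
  rw [ncard_eq_sum_ite]
  rfl

variable {K : Type*} [Field K]

lemma ncard_head_mem {K : Type*} [Fintype K] (n : ℕ) (T : Finset K) :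
    {y : Fin (n + 1) → K | y 0 ∈ T}.ncard = T.card * Fintype.card K ^ n := by
  classical
  have h1 : ∀ a, {z : Fin n → K | (Fin.cons a z : Fin (n + 1) → K) ∈ {y | y 0 ∈ T}}.ncard =
      if a ∈ T then Fintype.card K ^ n else 0 := by
    intro a
    split_ifs with h
    · simp [h, Set.ncard_univ]
    · simp [h]
  rw [ncard_eq_sum_cons_head, Finset.sum_congr rfl fun a _ => h1 a, Finset.sum_ite_mem,
    Finset.univ_inter, Finset.sum_const, smul_eq_mul]

lemma ncard_prefix_zero [Fintype K] {n r : ℕ} (hr : r ≤ n) :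
    {y : Fin n → K | ∀ i : Fin r, y (Fin.castLE hr i) = 0}.ncard = Fintype.card K ^ (n - r) := by
  have h1 : LinearIndependent K fun i : Fin r => (Pi.single (Fin.castLE hr i) 1 : Fin n → K) := by
    have := (Pi.basisFun K (Fin n)).linearIndependent.comp _ (Fin.castLE_injective hr)
    convert this using 1
    ext i : 1
    simp
  rw [← ncard_common_zeros_linear h1]
  simp

/-- The product of the linear forms of the hyperplanes `x₁ = c x₀`, for `c ∈ T`. -/
noncomputable def pencilProduct (k : ℕ) (T : Finset K) : MvPolynomial (Fin (k + 2)) K :=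
  ∏ c ∈ T, (X 1 - C c * X 0)

lemma eval_pencilProduct {k : ℕ} (T : Finset K) (x : Fin (k + 2) → K) :
    eval x (pencilProduct k T) = ∏ c ∈ T, (x 1 - c * x 0) := by
  simp [pencilProduct]

lemma isHomogeneous_pencilProduct {k : ℕ} (T : Finset K) :
    (pencilProduct k T).IsHomogeneous T.card := by
  have := IsHomogeneous.prod T (fun c => (X 1 - C c * X 0 : MvPolynomial (Fin (k + 2)) K))
    (fun _ => 1) fun c _ => (isHomogeneous_X K 1).sub ((isHomogeneous_X K 0).C_mul c)
  rwa [Finset.sum_const, smul_eq_mul, mul_one] at this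

lemma pencilProduct_ne_zero {k : ℕ} (T : Finset K) : pencilProduct k T ≠ 0 := by
  intro h
  have h1 := eval_pencilProduct T (Pi.single 1 1 : Fin (k + 2) → K)
  rw [h, map_zero] at h1
  simp at h1

/-- A system of forms attaining the bound. -/
noncomputable def pencilSystem {k r : ℕ} (hr : r ≤ k + 2) (T : Finset K) (i : Fin r) :
    MvPolynomial (Fin (k + 2)) K :=
  pencilProduct k T * X (Fin.castLE hr i + 1)

lemma isHomogeneous_pencilSystem {k r : ℕ} (hr : r ≤ k + 2) (T : Finset K) (i : Fin r) :
    (pencilSystem hr T i).IsHomogeneous (T.card + 1) :=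
  (isHomogeneous_pencilProduct T).mul (isHomogeneous_X K _)

lemma linearIndependent_pencilSystem {k r : ℕ} (hr : r ≤ k + 2) (T : Finset K) :
    LinearIndependent K (pencilSystem hr T) := by
  have h1 : LinearIndependent K
      fun i : Fin r => (X (Fin.castLE hr i + 1) : MvPolynomial (Fin (k + 2)) K) :=
    (linearIndependent_X (Fin (k + 2)) K).comp (fun i : Fin r => Fin.castLE hr i + 1)
      ((add_left_injective 1).comp (Fin.castLE_injective hr))
  refine h1.map' (LinearMap.mulLeft K (pencilProduct k T)) ?_
  rw [LinearMap.ker_eq_bot]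
  exact mul_right_injective₀ (pencilProduct_ne_zero T)

lemma eval_cons_pencilSystem_eq_zero {k r : ℕ} (hr : r ≤ k + 2) {T : Finset K} {a c : K}
    {y : Fin (k + 1) → K} (hc : c ∈ T) (hy : y 0 = c * a) (i : Fin r) :
    eval (Fin.cons a y : Fin (k + 2) → K) (pencilSystem hr T i) = 0 := by
  have h1 : (Fin.cons a y : Fin (k + 2) → K) 1 = y 0 := rfl
  rw [pencilSystem, map_mul, eval_pencilProduct, Finset.prod_eq_zero hc, zero_mul]
  rw [h1, Fin.cons_zero, hy, sub_self]

lemma le_ncard_zeros_pencilSystem_fiber_zero [Fintype K] {k r : ℕ} (hr : r ≤ k + 2)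
    {T : Finset K} (hT : T.Nonempty) : Fintype.card K ^ k ≤ {y : Fin (k + 1) → K |
      ∀ i, eval (Fin.cons 0 y : Fin (k + 2) → K) (pencilSystem hr T i) = 0}.ncard := by
  have h1 := ncard_head_mem k ({0} : Finset K)
  rw [Finset.card_singleton, one_mul] at h1
  rw [← h1]
  obtain ⟨c, hc⟩ := hT
  refine Set.ncard_le_ncard fun y hy => eval_cons_pencilSystem_eq_zero hr hc ?_
  rw [mul_zero]
  exact Finset.mem_singleton.1 hy

lemma le_ncard_zeros_pencilSystem_fiber [Fintype K] {k r : ℕ} (hr1 : 1 ≤ r) (hr : r ≤ k + 2)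
    {T : Finset K} (hT0 : (0 : K) ∉ T) {a : K} (ha : a ≠ 0) :
    T.card * Fintype.card K ^ k + flq (Fintype.card K) (k + 1) r ≤ {y : Fin (k + 1) → K |
      ∀ i, eval (Fin.cons a y : Fin (k + 2) → K) (pencilSystem hr T i) = 0}.ncard := by
  classical
  have h1 := ncard_head_mem k (T.image (· * a))
  rw [Finset.card_image_of_injective _ (mul_left_injective₀ ha)] at h1
  have h2 : {y : Fin (k + 1) → K | y 0 ∈ T.image (· * a)} ⊆
      {y | ∀ i, eval (Fin.cons a y : Fin (k + 2) → K) (pencilSystem hr T i) = 0} := by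
    intro y hy
    obtain ⟨c, hc, hcy⟩ := Finset.mem_image.1 hy
    exact eval_cons_pencilSystem_eq_zero hr hc hcy.symm
  by_cases hrk : r ≤ k + 1
  · rw [flq, if_pos hrk, ← ncard_prefix_zero (K := K) hrk, ← h1, ← Set.ncard_union_eq]
    · refine Set.ncard_le_ncard (Set.union_subset h2 ?_)
      intro y hy i
      have h3 : Fin.castLE hr i + 1 = (Fin.castLE hrk i).succ := by
        ext
        rw [Fin.val_add_one_of_lt]
        · simp
        · rw [Fin.lt_def, Fin.val_castLE, Fin.val_last]
          omega
      have h4 : y (Fin.castLE hrk i) = 0 := hy i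
      rw [pencilSystem, map_mul, eval_X, h3, Fin.cons_succ, h4, mul_zero]
    · rw [Set.disjoint_left]
      intro y hy hy'
      obtain ⟨c, hc, hcy⟩ := Finset.mem_image.1 hy
      have h3 : y 0 = 0 := hy' ⟨0, hr1⟩
      rw [h3] at hcy
      rcases mul_eq_zero.1 hcy with h4 | h4
      · exact hT0 (h4 ▸ hc)
      · exact ha h4
  · rw [flq, if_neg hrk, add_zero, ← h1]
    exact Set.ncard_le_ncard h2

lemma le_ncard_zeros_pencilSystem [Fintype K] {k r : ℕ} (hr1 : 1 ≤ r) (hr : r ≤ k + 2)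
    {T : Finset K} (hT0 : (0 : K) ∉ T) (hT : T.Nonempty) :
    (Fintype.card K - 1) * T.card * Fintype.card K ^ k + Fintype.card K ^ k +
        (Fintype.card K - 1) * flq (Fintype.card K) (k + 1) r ≤
      {x : Fin (k + 2) → K | x ≠ 0 ∧ ∀ i, eval x (pencilSystem hr T i) = 0}.ncard + 1 := by
  classical
  have h0 : {x : Fin (k + 2) → K | x ≠ 0 ∧ ∀ i, eval x (pencilSystem hr T i) = 0} =
      {x : Fin (k + 2) → K | ∀ i, eval x (pencilSystem hr T i) = 0} \ {0} := by
    ext x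
    simp [and_comm]
  rw [h0, Set.ncard_sdiff_singleton_add_one fun i => by simp [pencilSystem],
    ncard_eq_sum_cons_head, ← Finset.add_sum_erase _ _ (Finset.mem_univ (0 : K))]
  have h1 := Finset.card_nsmul_le_sum (Finset.univ.erase (0 : K)) _ _
    fun a ha => le_ncard_zeros_pencilSystem_fiber hr1 hr hT0 (Finset.ne_of_mem_erase ha)
  rw [Finset.card_erase_of_mem (Finset.mem_univ _), Finset.card_univ, smul_eq_mul] at h1
  refine le_trans (le_of_eq ?_)
    (Nat.add_le_add (le_ncard_zeros_pencilSystem_fiber_zero hr hT) h1)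
  ring

end Attainment

/-- Main theorem: for `1 ≤ d < q-1` and `1 ≤ r ≤ m+1`, the maximum number of common
zeros in `ℙ^m(F_q)` of `r` linearly independent homogeneous polynomials of degree `d`
in `F_q[x₀,…,x_m]` equals `p_(m-r)` if `d = 1` and `(d-1)q^(m-1) + p_(m-2) + ⌊q^(m-r)⌋`
if `d > 1`; moreover, if `d > 1` and the maximum is attained by `F₁,…,F_r`, then
`F₁,…,F_r` have a common linear factor. -/
theorem tsfasman_boguslavsky (q d m r : ℕ) {K : Type} [Field K] [Fintype K]
    (hq : Fintype.card K = q) (hm : 1 ≤ m) (hd : 1 ≤ d) (hdq : d < q - 1)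
    (hr : 1 ≤ r) (hrm : r ≤ m + 1) :
    IsGreatest {N : ℕ | ∃ Fs : Fin r → MvPolynomial (Fin (m + 1)) K,
        LinearIndependent K Fs ∧ (∀ i, (Fs i).IsHomogeneous d) ∧
        N = Set.ncard {x : Projectivization K (Fin (m + 1) → K) |
              ∀ i, eval x.rep (Fs i) = 0}}
      (Tbound q d m r) ∧
    (1 < d → ∀ Fs : Fin r → MvPolynomial (Fin (m + 1)) K,
      LinearIndependent K Fs → (∀ i, (Fs i).IsHomogeneous d) →
      Set.ncard {x : Projectivization K (Fin (m + 1) → K) |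
          ∀ i, eval x.rep (Fs i) = 0} = Tbound q d m r →
      ∃ H : MvPolynomial (Fin (m + 1)) K,
        H.IsHomogeneous 1 ∧ H ≠ 0 ∧ ∀ i, H ∣ Fs i) := by
  subst hq
  obtain ⟨k, rfl⟩ : ∃ k, m = k + 1 := ⟨m - 1, by omega⟩
  obtain rfl | hd2 : d = 1 ∨ 2 ≤ d := by omega
  · refine ⟨⟨?_, ?_⟩, fun h => absurd h (lt_irrefl 1)⟩
    · have h1 := linearIndependent_pencilSystem (K := K) hrm ∅
      have h2 := isHomogeneous_pencilSystem (K := K) hrm ∅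
      exact ⟨_, h1, h2, (ncard_zeros_eq_Tbound_one h1 h2).symm⟩
    · rintro N ⟨Fs, h1, h2, rfl⟩
      exact (ncard_zeros_eq_Tbound_one h1 h2).le
  have hT := mul_Tbound_add_one (q := Fintype.card K) (by omega) hd2 k r
  have hub : ∀ Fs : Fin r → MvPolynomial (Fin (k + 1 + 1)) K, LinearIndependent K Fs →
      (∀ i, (Fs i).IsHomogeneous d) →
      {x : Projectivization K (Fin (k + 1 + 1) → K) | ∀ i, eval x.rep (Fs i) = 0}.ncard ≤
        Tbound (Fintype.card K) d (k + 1) r := by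
    intro Fs h1 h2
    have h3 := (card_common_zeros_le hr h1 h2 hd2 (by omega)).1
    rw [← hT, ← mul_ncard_projective_zeros h2, Nat.add_le_add_iff_right] at h3
    exact Nat.le_of_mul_le_mul_left h3 (by omega)
  refine ⟨⟨?_, ?_⟩, ?_⟩
  · classical
    obtain ⟨T, hT1, hT2⟩ := Finset.exists_subset_card_eq (s := Finset.univ.erase (0 : K))
      (n := d - 1) (by
        rw [Finset.card_erase_of_mem (Finset.mem_univ _), Finset.card_univ]
        omega)
    have h1 := linearIndependent_pencilSystem (K := K) hrm T
    have h2 := isHomogeneous_pencilSystem (K := K) hrm T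
    rw [hT2, Nat.sub_add_cancel hd] at h2
    refine ⟨_, h1, h2, le_antisymm ?_ (hub _ h1 h2)⟩
    have h3 := le_ncard_zeros_pencilSystem hr hrm (T := T)
      (fun h => Finset.ne_of_mem_erase (hT1 h) rfl) (Finset.card_pos.1 (by omega))
    rw [hT2, ← hT, ← mul_ncard_projective_zeros h2, Nat.add_le_add_iff_right] at h3
    exact Nat.le_of_mul_le_mul_left h3 (by omega)
  · rintro N ⟨Fs, h1, h2, rfl⟩
    exact hub Fs h1 h2
  · intro _ Fs h1 h2 h3
    obtain ⟨u, hu, hdvd⟩ := (card_common_zeros_le hr h1 h2 hd2 (by omega)).2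
      (by rw [← hT, ← mul_ncard_projective_zeros h2, h3])
    exact ⟨linForm u, isHomogeneous_linForm u, linForm_ne_zero hu, hdvd⟩
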